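/- Let p be the Poisson(1) offspring law p(ℓ) = e^{-1}/ℓ! for ℓ = 0,1,2,…. Then I_p(x) = 1 − x + x log x for x ≥ 0, and consequently, for a Markov chain X with irreducible kernel Q indexed by the Galton-Watson tree with offspring law p conditioned on {|T| = n} (equivalently, a uniformly random unordered tree with n vertices), the empirical pair measure L_X satisfies a large deviation principle with speed n and good rate function I(μ) = H(μ ∥ μ₁ ⊗ Q) + H(μ₁ ∥ μ₂). -/

import Mathlib

open scoped ENNReal NNReal BigOperators
open Filter

/-- Finite rooted planar trees with vertex types in `𝒳`. -/
inductive PTree (𝒳 : Type*) where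
  | node : 𝒳 → List (PTree 𝒳) → PTree 𝒳

namespace PTree

variable {𝒳 : Type*}

/-- The type of the root. -/
def root : PTree 𝒳 → 𝒳
  | node a _ => a

/-- The list of subtrees rooted at the children of the root (left to right). -/
def children : PTree 𝒳 → List (PTree 𝒳)
  | node _ ts => ts

/-- The types of the children of the root, from left to right. -/
def childLabels (t : PTree 𝒳) : List 𝒳 := t.children.map root

/-- The list of all subtrees `X^v`, `v` a vertex of the tree. -/
def subtrees : PTree 𝒳 → List (PTree 𝒳)
  | node a ts => node a ts :: (ts.attach.map (fun s => subtrees s.1)).flatten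
decreasing_by
  have := List.sizeOf_lt_of_mem s.2
  simp only [PTree.node.sizeOf_spec]
  omega

/-- Number of vertices. -/
def size (t : PTree 𝒳) : ℕ := t.subtrees.length

/-- The vertices at depth exactly `k`, as subtrees, from left to right. -/
def atDepth : ℕ → PTree 𝒳 → List (PTree 𝒳)
  | 0, t => [t]
  | (k+1), node _ ts => (ts.attach.map (fun s => atDepth k s.1)).flatten

/-- Truncation of a tree at height `k` (keeping the generations `0,…,k`). -/
def trunc : ℕ → PTree 𝒳 → PTree 𝒳
  | 0, node a _ => node a []
  | (k+1), node a ts => node a (ts.attach.map (fun s => trunc k s.1))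

/-- The height of a tree (largest `k` such that generation `k` is nonempty). -/
def height : PTree 𝒳 → ℕ
  | node _ [] => 0
  | node _ (t :: ts) => ((t :: ts).attach.map (fun s => height s.1)).foldr max 0 + 1
decreasing_by
  have := List.sizeOf_lt_of_mem s.2
  simp only [PTree.node.sizeOf_spec] at *
  omega

/-- The largest offspring number in the tree. -/
def maxDeg : PTree 𝒳 → ℕ
  | node _ ts => max ts.length (((ts.attach.map (fun s => maxDeg s.1)).foldr max 0))
decreasing_by
  have := List.sizeOf_lt_of_mem s.2
  simp only [PTree.node.sizeOf_spec] at *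
  omega

end PTree
noncomputable instance {𝒳 : Type*} : DecidableEq (PTree 𝒳) := Classical.decEq _

/-- Extended-real logarithm of an extended nonnegative real. -/
noncomputable def elog (x : ℝ≥0∞) : EReal :=
  if x = 0 then ⊥ else if x = ∞ then ⊤ else ((Real.log x.toReal : ℝ) : EReal)

open Classical in
/-- Relative entropy `H(ν ‖ ρ)` of two (probability) vectors on a countable set,
with value `∞` if `ν` is not absolutely continuous with respect to `ρ`.  (For
probability vectors each summand below is nonnegative and the sum equals
`∑ ν a log (ν a / ρ a)`.) -/
noncomputable def relEnt {α : Type*} (ν ρ : α → ℝ) : ℝ≥0∞ :=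
  if ∀ a, ρ a = 0 → ν a = 0 then
    ∑' a, ENNReal.ofReal (ν a * Real.log (ν a / ρ a) + ρ a - ν a)
  else ∞

/-- The Cramér rate function `I_p(x) = sup_λ {λx - log ∑ p(n) e^{λn}}`. -/
noncomputable def cramerRate (p : ℕ → ℝ) (x : ℝ) : EReal :=
  ⨆ lam : ℝ, ((lam * x - Real.log (∑' n : ℕ, p n * Real.exp (lam * n)) : ℝ) : EReal)

/-- Total mass `P{|T| = n}` assigned by the weight `w` to trees with `n` vertices. -/
noncomputable def treeMass {𝒳 : Type*} (w : PTree 𝒳 → ℝ) (n : ℕ) : ℝ≥0∞ :=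
  ∑' t : PTree 𝒳, if t.size = n then ENNReal.ofReal (w t) else 0

open Classical in
/-- Conditional probability of the event `E` given `{|T| = n}`, for the (sub)probability
weight `w` on finite planar trees.  -/
noncomputable def condP {𝒳 : Type*} (w : PTree 𝒳 → ℝ) (n : ℕ) (E : Set (PTree 𝒳)) : ℝ≥0∞ :=
  (∑' t : PTree 𝒳, if t.size = n ∧ t ∈ E then ENNReal.ofReal (w t) else 0) / treeMass w n

/-- The set of sizes having positive probability. -/
noncomputable def sizeSupport {𝒳 : Type*} (w : PTree 𝒳 → ℝ) : Set ℕ := {n | 0 < treeMass w n}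
section TreeIndexedChain

variable {𝒳 : Type*} [Fintype 𝒳] [DecidableEq 𝒳]

/-- The joint weight of a typed tree under the Galton-Watson law with offspring
distribution `p`, initial type distribution `μ0` and Markov transition kernel `Q`:
`μ0(root) ∏_v p(N(v)) ∏_{children w of v} Q(type w | type v)`. -/
noncomputable def jointWeight (p : ℕ → ℝ) (μ0 : 𝒳 → ℝ) (Q : 𝒳 → 𝒳 → ℝ) (t : PTree 𝒳) : ℝ :=
  μ0 t.root *
    (t.subtrees.map (fun s => p s.children.length *
      (s.children.map (fun c => Q s.root c.root)).prod)).prod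

/-- The number of edges of `t` whose beginning vertex has type `a` and whose end
vertex has type `b`. -/
noncomputable def pairCount (t : PTree 𝒳) (a b : 𝒳) : ℕ :=
  (t.subtrees.map (fun s => if s.root = a then s.childLabels.count b else 0)).sum

/-- The empirical pair measure `L_X`. -/
noncomputable def empPair (t : PTree 𝒳) : 𝒳 × 𝒳 → ℝ :=
  fun x => (pairCount t x.1 x.2 : ℝ) / ((t.size : ℝ) - 1)

/-- Probability vectors on `𝒳 × 𝒳`. -/
def IsProbVec (μ : 𝒳 × 𝒳 → ℝ) : Prop := (∀ x, 0 ≤ μ x) ∧ ∑ x, μ x = 1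

/-- The space of probability vectors on `𝒳 × 𝒳` (with its natural topology). -/
abbrev PV (𝒳 : Type*) [Fintype 𝒳] [DecidableEq 𝒳] := {μ : 𝒳 × 𝒳 → ℝ // IsProbVec μ}

end TreeIndexedChain
section Statement3

variable {𝒳 : Type*} [Fintype 𝒳] [DecidableEq 𝒳]

/-- The Poisson(1) offspring law `p(ℓ) = e^{-1}/ℓ!`. -/
noncomputable def poissonLaw (ℓ : ℕ) : ℝ := Real.exp (-1) / (Nat.factorial ℓ)

/-- The rate function for the empirical pair measure of a Markov chain indexed by a
uniform random unordered tree with `n` vertices: `I(μ) = H(μ ‖ μ₁ ⊗ Q) + H(μ₁ ‖ μ₂)`. -/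
noncomputable def ratePoisson (Q : 𝒳 → 𝒳 → ℝ) (μ : 𝒳 × 𝒳 → ℝ) : EReal :=
  let μ1 : 𝒳 → ℝ := fun a => ∑ b, μ (a, b)
  let μ2 : 𝒳 → ℝ := fun b => ∑ a, μ (a, b)
  (relEnt μ (fun x => μ1 x.1 * Q x.1 x.2) : EReal) + (relEnt μ1 μ2 : EReal)

/-! ### Finite typed trees -/

section Trees

variable {𝒴 : Type*}

namespace PTree

lemma subtrees_node (a : 𝒴) (ts : List (PTree 𝒴)) :
    (node a ts).subtrees = node a ts :: (ts.map subtrees).flatten := by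
  rw [subtrees]
  congr 2
  exact List.attach_map_val

/-- Structural induction on trees through the list of children of the root. -/
lemma induction_children {C : PTree 𝒴 → Prop}
    (H : ∀ a ts, (∀ t ∈ ts, C t) → C (node a ts)) : ∀ t, C t
  | node a ts => H a ts fun t ht => induction_children H t
decreasing_by
  have := List.sizeOf_lt_of_mem ht
  simp only [PTree.node.sizeOf_spec]
  omega

lemma size_node (a : 𝒴) (ts : List (PTree 𝒴)) :
    (node a ts).size = (ts.map size).sum + 1 := by
  simp only [size, subtrees_node, List.length_cons, List.length_flatten, List.map_map]
  rfl

/-- The product over the vertices of a tree of a vertex factor depending on the type and the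
number of children, times the product of the edge factors. -/
def treeProd {R : Type*} [CommSemiring R] (P : 𝒴 → ℕ → R) (q : 𝒴 → 𝒴 → R) (t : PTree 𝒴) : R :=
  (t.subtrees.map fun s => P s.root s.children.length *
    (s.children.map fun c => q s.root c.root).prod).prod

lemma treeProd_node {R : Type*} [CommSemiring R] (P : 𝒴 → ℕ → R) (q : 𝒴 → 𝒴 → R) (a : 𝒴)
    (ts : List (PTree 𝒴)) :
    treeProd P q (node a ts) =
      P a ts.length * (ts.map fun c => q a c.root * treeProd P q c).prod := by
  rw [treeProd, subtrees_node, List.map_cons, List.prod_cons, List.map_flatten, List.prod_flatten,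
    List.map_map, List.map_map, List.prod_map_mul, mul_assoc]
  rfl

lemma treeProd_nonneg {P : 𝒴 → ℕ → ℝ} {q : 𝒴 → 𝒴 → ℝ} (hP : ∀ a m, 0 ≤ P a m)
    (hq : ∀ a b, 0 ≤ q a b) (t : PTree 𝒴) : 0 ≤ treeProd P q t := by
  refine List.prod_nonneg fun x hx => ?_
  obtain ⟨s, -, rfl⟩ := List.mem_map.1 hx
  refine mul_nonneg (hP _ _) (List.prod_nonneg fun y hy => ?_)
  obtain ⟨c, -, rfl⟩ := List.mem_map.1 hy
  exact hq _ _

end PTree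

lemma pairCount_node [DecidableEq 𝒴] (a : 𝒴) (ts : List (PTree 𝒴)) (x y : 𝒴) :
    pairCount (PTree.node a ts) x y =
      (if a = x then (ts.map PTree.root).count y else 0) +
        (ts.map fun t => pairCount t x y).sum := by
  rw [pairCount, PTree.subtrees_node, List.map_cons, List.sum_cons, List.map_flatten,
    List.sum_flatten, List.map_map, List.map_map]
  rfl

variable [Fintype 𝒴]

/-- The trees with root type `a` having fewer than `h` levels and offspring numbers below `h`. -/
noncomputable def boundedTrees : ℕ → 𝒴 → Finset (PTree 𝒴)
  | 0, _ => ∅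
  | h + 1, a => (Finset.range (h + 1)).biUnion fun m =>
      (Fintype.piFinset fun _ : Fin m => Finset.univ.biUnion (boundedTrees h)).image
        fun f => PTree.node a (List.ofFn f)

lemma root_of_mem_boundedTrees {h : ℕ} {a : 𝒴} {t : PTree 𝒴} (ht : t ∈ boundedTrees h a) :
    t.root = a := by
  cases h with
  | zero => simp [boundedTrees] at ht
  | succ h =>
    simp only [boundedTrees, Finset.mem_biUnion, Finset.mem_image] at ht
    obtain ⟨m, -, f, -, rfl⟩ := ht
    rfl

lemma pairwise_disjoint_boundedTrees (h : ℕ) :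
    Pairwise (Function.onFun Disjoint (boundedTrees (𝒴 := 𝒴) h)) := by
  intro b c hbc
  refine Finset.disjoint_left.2 fun t hb hc => hbc ?_
  rw [← root_of_mem_boundedTrees hb, root_of_mem_boundedTrees hc]

lemma node_mem_boundedTrees_succ {h : ℕ} {a : 𝒴} {ts : List (PTree 𝒴)} :
    PTree.node a ts ∈ boundedTrees (h + 1) a ↔
      ts.length ≤ h ∧ ∀ t ∈ ts, t ∈ boundedTrees h t.root := by
  simp only [boundedTrees, Finset.mem_biUnion, Finset.mem_image, Finset.mem_range,
    Fintype.mem_piFinset, Finset.mem_univ, true_and, PTree.node.injEq, Nat.lt_succ_iff]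
  constructor
  · rintro ⟨m, hm, f, hf, rfl⟩
    refine ⟨by simpa using hm, fun t ht => ?_⟩
    obtain ⟨i, rfl⟩ := (List.mem_ofFn' f t).1 ht
    obtain ⟨b, hb⟩ := hf i
    rwa [root_of_mem_boundedTrees hb]
  · rintro ⟨hl, ht⟩
    exact ⟨ts.length, hl, ts.get, fun i => ⟨_, ht _ (ts.get_mem i)⟩, List.ofFn_get ts⟩

lemma boundedTrees_subset_succ (h : ℕ) (a : 𝒴) : boundedTrees h a ⊆ boundedTrees (h + 1) a := by
  induction h generalizing a with
  | zero => simp [boundedTrees]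
  | succ h ih =>
    intro t ht
    have hr := root_of_mem_boundedTrees ht
    obtain ⟨b, ts⟩ := t
    obtain rfl : b = a := hr
    rw [node_mem_boundedTrees_succ] at ht ⊢
    exact ⟨by omega, fun t h' => ih _ (ht.2 t h')⟩

lemma boundedTrees_mono (a : 𝒴) : Monotone fun h => boundedTrees h a :=
  monotone_nat_of_le_succ fun h => boundedTrees_subset_succ h a

lemma exists_mem_boundedTrees (t : PTree 𝒴) : ∃ h, t ∈ boundedTrees h t.root := by
  induction t using PTree.induction_children with
  | H a ts ih =>
    choose! g hg using ih
    refine ⟨max ts.length ((ts.map g).sum) + 1, ?_⟩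
    refine node_mem_boundedTrees_succ.2 ⟨le_max_left _ _, fun t ht => ?_⟩
    refine boundedTrees_mono _ (le_trans ?_ (le_max_right _ _)) (hg t ht)
    exact List.le_sum_of_mem (List.mem_map_of_mem ht)

lemma sum_boundedTrees_succ {R : Type*} [CommSemiring R] (P : 𝒴 → ℕ → R) (q : 𝒴 → 𝒴 → R)
    (h : ℕ) (a : 𝒴) :
    ∑ t ∈ boundedTrees (h + 1) a, t.treeProd P q =
      ∑ m ∈ Finset.range (h + 1),
        P a m * (∑ b, q a b * ∑ t ∈ boundedTrees h b, t.treeProd P q) ^ m := by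
  rw [boundedTrees, Finset.sum_biUnion]
  · refine Finset.sum_congr rfl fun m _ => ?_
    rw [Finset.sum_image]
    · have hsum : ∑ b, q a b * ∑ t ∈ boundedTrees h b, t.treeProd P q =
          ∑ t ∈ Finset.univ.biUnion (boundedTrees h), q a t.root * t.treeProd P q := by
        rw [Finset.sum_biUnion]
        · refine Finset.sum_congr rfl fun b _ => ?_
          rw [Finset.mul_sum]
          exact Finset.sum_congr rfl fun t ht => by rw [root_of_mem_boundedTrees ht]
        · exact (pairwise_disjoint_boundedTrees h).set_pairwise _
      have hpow := Finset.prod_univ_sum (fun _ : Fin m => Finset.univ.biUnion (boundedTrees h))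
        fun _ t => q a t.root * t.treeProd P q
      rw [Finset.prod_const, Finset.card_univ, Fintype.card_fin] at hpow
      rw [hsum, hpow, Finset.mul_sum]
      refine Finset.sum_congr rfl fun f _ => ?_
      rw [PTree.treeProd_node, List.length_ofFn, List.map_ofFn, List.prod_ofFn]
      rfl
    · intro f _ g _ hfg
      simpa using hfg
  · intro m _ m' _ hmm
    refine Finset.disjoint_left.2 fun t ht ht' => hmm ?_
    obtain ⟨f, -, rfl⟩ := Finset.mem_image.1 ht
    obtain ⟨g, -, hg⟩ := Finset.mem_image.1 ht'
    simpa [PTree.children] using (congrArg (fun t => t.children.length) hg).symm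

variable [DecidableEq 𝒴]

/-- The pair counts of a tree as an exponent vector. -/
noncomputable def pairExp (t : PTree 𝒴) : 𝒴 × 𝒴 →₀ ℕ :=
  Finsupp.equivFunOnFinite.symm fun x => pairCount t x.1 x.2

lemma pairExp_apply (t : PTree 𝒴) (x : 𝒴 × 𝒴) : pairExp t x = pairCount t x.1 x.2 := rfl

lemma pairExp_node (a : 𝒴) (ts : List (PTree 𝒴)) :
    pairExp (PTree.node a ts) =
      (ts.map fun c => Finsupp.single (a, c.root) 1 + pairExp c).sum := by
  ext ⟨x, y⟩
  rw [pairExp_apply, pairCount_node]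
  induction ts with
  | nil => simp
  | cons c ts ih =>
    simp only [List.map_cons, List.sum_cons, Finsupp.add_apply, ← ih, pairExp_apply,
      Finsupp.single_apply, Prod.mk.injEq, List.count_cons, beq_iff_eq]
    by_cases hx : a = x <;> by_cases hy : c.root = y <;> simp [hx, hy] <;> omega

/-- The sum of `ψ` over the edges of a tree with pair counts `N`, as a homomorphism in `N`. -/
noncomputable def edgeSum {A : Type*} [CommSemiring A] (ψ : 𝒴 × 𝒴 → A) :
    (𝒴 × 𝒴 →₀ ℕ) →+ A where
  toFun N := ∑ x, (N x : A) * ψ x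
  map_zero' := by simp
  map_add' N N' := by simp [add_mul, Finset.sum_add_distrib]

lemma edgeSum_apply {A : Type*} [CommSemiring A] (ψ : 𝒴 × 𝒴 → A) (N : 𝒴 × 𝒴 →₀ ℕ) :
    edgeSum ψ N = ∑ x, (N x : A) * ψ x := rfl

lemma edgeSum_single {A : Type*} [CommSemiring A] (ψ : 𝒴 × 𝒴 → A) (x : 𝒴 × 𝒴) (n : ℕ) :
    edgeSum ψ (Finsupp.single x n) = n * ψ x := by
  rw [edgeSum_apply, Finset.sum_eq_single x]
  · simp
  · intro y _ hy
    simp [hy.symm]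
  · simp

lemma edgeSum_pairExp_node {A : Type*} [CommSemiring A] (ψ : 𝒴 × 𝒴 → A) (a : 𝒴)
    (ts : List (PTree 𝒴)) :
    edgeSum ψ (pairExp (PTree.node a ts)) =
      (ts.map fun c => ψ (a, c.root) + edgeSum ψ (pairExp c)).sum := by
  rw [pairExp_node, map_list_sum, List.map_map]
  congr 1
  refine List.map_congr_left fun c _ => ?_
  simp [edgeSum_single]

lemma PTree.size_eq_edgeSum (t : PTree 𝒴) : t.size = edgeSum 1 (pairExp t) + 1 := by
  induction t using PTree.induction_children with
  | H a ts ih =>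
    rw [PTree.size_node, edgeSum_pairExp_node]
    congr 2
    refine List.map_congr_left fun c hc => ?_
    rw [ih c hc, add_comm]
    rfl

/-- Changing the vertex and edge factors exponentially changes the weight of a tree by the
exponential of a linear function of the pair counts. -/
lemma PTree.treeProd_tilt (P : 𝒴 → ℕ → ℝ) (q : 𝒴 → 𝒴 → ℝ) (φ : 𝒴 → ℝ) (θ : 𝒴 × 𝒴 → ℝ)
    (t : PTree 𝒴) :
    t.treeProd (fun a m => P a m * Real.exp (φ a)) (fun a b => q a b * Real.exp (θ (a, b))) =
      t.treeProd P q *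
        Real.exp (edgeSum (fun x => θ x + φ x.2) (pairExp t) + φ t.root) := by
  induction t using PTree.induction_children with
  | H a ts ih =>
    rw [treeProd_node, treeProd_node, edgeSum_pairExp_node]
    have hprod : (ts.map fun c => q a c.root * Real.exp (θ (a, c.root)) *
          c.treeProd (fun a m => P a m * Real.exp (φ a))
            (fun a b => q a b * Real.exp (θ (a, b)))).prod =
        (ts.map fun c => q a c.root * c.treeProd P q).prod *
          Real.exp (ts.map fun c => θ (a, c.root) + φ c.root +
            edgeSum (fun x => θ x + φ x.2) (pairExp c)).sum := by
      rw [Real.exp_list_sum, List.map_map, ← List.prod_map_mul]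
      congr 1
      refine List.map_congr_left fun c hc => ?_
      rw [ih c hc, Function.comp_apply, Real.exp_add, Real.exp_add, Real.exp_add]
      ring
    rw [hprod, Real.exp_add]
    simp only [root]
    ring

end Trees

/-! ### Exponential upper bound -/

/-- The mass given by `w` to the trees with `n` vertices in `E`. -/
noncomputable def eventMass {𝒴 : Type*} (w : PTree 𝒴 → ℝ) (n : ℕ) (E : Set (PTree 𝒴)) : ℝ≥0∞ :=
  open Classical in ∑' t : PTree 𝒴, if t.size = n ∧ t ∈ E then ENNReal.ofReal (w t) else 0

lemma condP_eq_eventMass_div {𝒴 : Type*} (w : PTree 𝒴 → ℝ) (n : ℕ) (E : Set (PTree 𝒴)) :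
    condP w n E = eventMass w n E / treeMass w n := rfl

lemma eventMass_univ {𝒴 : Type*} (w : PTree 𝒴 → ℝ) (n : ℕ) :
    eventMass w n Set.univ = treeMass w n := by
  simp [eventMass, treeMass]

lemma eventMass_mono {𝒴 : Type*} (w : PTree 𝒴 → ℝ) (n : ℕ) {E F : Set (PTree 𝒴)} (h : E ⊆ F) :
    eventMass w n E ≤ eventMass w n F := by
  refine ENNReal.tsum_le_tsum fun t => ?_
  split_ifs with h1 h2
  · exact le_rfl
  · exact absurd ⟨h1.1, h h1.2⟩ h2
  · exact zero_le
  · exact le_rfl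

/-- The trees whose empirical pair measure is a probability vector lying in `F`. -/
def pairEvent (F : Set (PV 𝒳)) : Set (PTree 𝒳) :=
  {t | ∃ h : IsProbVec (empPair t), (⟨empPair t, h⟩ : PV 𝒳) ∈ F}

lemma sum_boundedTrees_poisson_le_one {M : 𝒳 → 𝒳 → ℝ} (hM : ∀ a b, 0 ≤ M a b) (h : ℕ) (a : 𝒳) :
    ∑ t ∈ boundedTrees h a,
      t.treeProd (fun a m => Real.exp (-∑ b, M a b) / (Nat.factorial m)) M ≤ 1 := by
  induction h generalizing a with
  | zero => simp [boundedTrees]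
  | succ h ih =>
    rw [sum_boundedTrees_succ]
    have hP : ∀ (a : 𝒳) (m : ℕ), 0 ≤ Real.exp (-∑ b, M a b) / (Nat.factorial m) :=
      fun a m => by positivity
    set y := ∑ b, M a b * ∑ t ∈ boundedTrees h b,
      t.treeProd (fun a m => Real.exp (-∑ b, M a b) / (Nat.factorial m)) M with hy
    have hy0 : 0 ≤ y := Finset.sum_nonneg fun b _ => mul_nonneg (hM a b)
      (Finset.sum_nonneg fun t _ => PTree.treeProd_nonneg hP hM t)
    have hy1 : y ≤ ∑ b, M a b := Finset.sum_le_sum fun b _ =>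
      mul_le_of_le_one_right (hM a b) (ih b)
    calc ∑ m ∈ Finset.range (h + 1), Real.exp (-∑ b, M a b) / (Nat.factorial m) * y ^ m
        = Real.exp (-∑ b, M a b) * ∑ m ∈ Finset.range (h + 1), y ^ m / (Nat.factorial m) := by
          rw [Finset.mul_sum]
          exact Finset.sum_congr rfl fun m _ => by ring
      _ ≤ Real.exp (-∑ b, M a b) * Real.exp (∑ b, M a b) := by
          gcongr
          exact (Real.sum_le_exp_of_nonneg hy0 _).trans (Real.exp_le_exp.2 hy1)
      _ = 1 := by rw [← Real.exp_add]; simp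

lemma tsum_poisson_treeProd_le {M : 𝒳 → 𝒳 → ℝ} (hM : ∀ a b, 0 ≤ M a b) :
    ∑' t : PTree 𝒳, ENNReal.ofReal
      (t.treeProd (fun a m => Real.exp (-∑ b, M a b) / (Nat.factorial m)) M) ≤
        Fintype.card 𝒳 := by
  rw [ENNReal.tsum_eq_iSup_sum]
  refine iSup_le fun s => ?_
  choose g hg using exists_mem_boundedTrees (𝒴 := 𝒳)
  set h := s.sup g
  have hsub : s ⊆ Finset.univ.biUnion (boundedTrees (𝒴 := 𝒳) h) := fun t ht =>
    Finset.mem_biUnion.2 ⟨t.root, Finset.mem_univ _,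
      boundedTrees_mono _ (Finset.le_sup (f := g) ht) (hg t)⟩
  refine (Finset.sum_le_sum_of_subset hsub).trans ?_
  rw [Finset.sum_biUnion ((pairwise_disjoint_boundedTrees h).set_pairwise _)]
  calc _ ≤ ∑ _a : 𝒳, (1 : ℝ≥0∞) := by
        refine Finset.sum_le_sum fun a _ => ?_
        rw [← ENNReal.ofReal_sum_of_nonneg fun t _ =>
          PTree.treeProd_nonneg (fun a m => by positivity) hM t]
        exact ENNReal.ofReal_le_one.2 (sum_boundedTrees_poisson_le_one hM h a)
    _ = Fintype.card 𝒳 := by simp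

/-- The exponential rate gained by tilting the kernel `Q` by `exp θ`. -/
noncomputable def tiltRate (Q : 𝒳 → 𝒳 → ℝ) (θ : 𝒳 × 𝒳 → ℝ) (μ : 𝒳 × 𝒳 → ℝ) : ℝ :=
  ∑ x, μ x * θ x + 1 - ∑ x : 𝒳 × 𝒳, (∑ c, μ (c, x.1)) * (Q x.1 x.2 * Real.exp (θ x))

lemma continuous_tiltRate (Q : 𝒳 → 𝒳 → ℝ) (θ : 𝒳 × 𝒳 → ℝ) : Continuous (tiltRate Q θ) := by
  unfold tiltRate
  fun_prop

lemma jointWeight_eq {𝒴 : Type*} (p : ℕ → ℝ) (μ0 : 𝒴 → ℝ) (Q : 𝒴 → 𝒴 → ℝ) (t : PTree 𝒴) :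
    jointWeight p μ0 Q t = μ0 t.root * t.treeProd (fun _ => p) Q := rfl

lemma edgeSum_pairExp_eq (ψ : 𝒳 × 𝒳 → ℝ) {t : PTree 𝒳} (ht : 2 ≤ t.size) :
    edgeSum ψ (pairExp t) = ((t.size : ℝ) - 1) * ∑ x, empPair t x * ψ x := by
  have h : ((t.size : ℝ) - 1) ≠ 0 := by
    have : (2 : ℝ) ≤ t.size := by exact_mod_cast ht
    linarith
  rw [edgeSum_apply, Finset.mul_sum]
  refine Finset.sum_congr rfl fun x _ => ?_
  rw [pairExp_apply, empPair]
  field_simp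

lemma isProbVec_empPair {t : PTree 𝒳} (ht : 2 ≤ t.size) : IsProbVec (empPair t) := by
  have h : 0 < ((t.size : ℝ) - 1) := by
    have : (2 : ℝ) ≤ t.size := by exact_mod_cast ht
    linarith
  refine ⟨fun x => div_nonneg (Nat.cast_nonneg _) h.le, ?_⟩
  have h1 := edgeSum_pairExp_eq (fun _ => 1) ht
  have h2 : (t.size : ℝ) = edgeSum (fun _ => (1 : ℝ)) (pairExp t) + 1 := by
    rw [PTree.size_eq_edgeSum t]
    simp [edgeSum_apply]
  have h3 : ((t.size : ℝ) - 1) * (∑ x, empPair t x) = ((t.size : ℝ) - 1) * 1 := by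
    simp only [mul_one] at h1 ⊢
    linarith
  exact mul_left_cancel₀ h.ne' h3

lemma jointWeight_le_tilt {μ0 : 𝒳 → ℝ} (hμ0 : ∀ a, 0 ≤ μ0 a) (hμ0_sum : ∑ a, μ0 a = 1)
    {Q : 𝒳 → 𝒳 → ℝ} (hQ : ∀ a b, 0 ≤ Q a b) (θ : 𝒳 × 𝒳 → ℝ) (c : ℝ) {t : PTree 𝒳}
    (ht : 2 ≤ t.size) (hc : c ≤ tiltRate Q θ (empPair t)) :
    jointWeight poissonLaw μ0 Q t ≤
      Real.exp (∑ a, ∑ b, Q a b * Real.exp (θ (a, b))) * Real.exp (-(((t.size : ℝ) - 1) * c)) *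
        t.treeProd (fun a m => Real.exp (-∑ b, Q a b * Real.exp (θ (a, b))) / (Nat.factorial m))
          (fun a b => Q a b * Real.exp (θ (a, b))) := by
  have hn : 0 < ((t.size : ℝ) - 1) := by
    have : (2 : ℝ) ≤ t.size := by exact_mod_cast ht
    linarith
  set m : 𝒳 → ℝ := fun a => ∑ b, Q a b * Real.exp (θ (a, b)) with hm
  have hm0 : ∀ a, 0 ≤ m a := fun a => Finset.sum_nonneg fun b _ =>
    mul_nonneg (hQ a b) (Real.exp_pos _).le
  have hu : 0 ≤ t.treeProd (fun _ => poissonLaw) Q :=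
    PTree.treeProd_nonneg (fun _ _ => by unfold poissonLaw; positivity) hQ t
  have hP : (fun (a : 𝒳) (k : ℕ) => Real.exp (-m a) / (Nat.factorial k : ℝ)) =
      fun a k => poissonLaw k * Real.exp (1 - m a) := by
    ext a k
    rw [poissonLaw, div_mul_eq_mul_div, ← Real.exp_add]
    congr 2
    ring
  have htilt := t.treeProd_tilt (fun _ => poissonLaw) Q (fun a => 1 - m a) θ
  rw [hP, htilt, jointWeight_eq]
  have hrate : ∑ x : 𝒳 × 𝒳, empPair t x * (θ x + (1 - m x.2)) = tiltRate Q θ (empPair t) := by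
    have h1 := (isProbVec_empPair ht).2
    have h2 : ∑ x : 𝒳 × 𝒳, empPair t x * m x.2 = ∑ x : 𝒳 × 𝒳,
        (∑ c, empPair t (c, x.1)) * (Q x.1 x.2 * Real.exp (θ x)) := by
      rw [Fintype.sum_prod_type_right, Fintype.sum_prod_type]
      refine Finset.sum_congr rfl fun a _ => ?_
      simp only [hm]
      rw [← Finset.sum_mul, ← Finset.mul_sum]
    rw [tiltRate, ← h2]
    simp only [mul_add, mul_sub, mul_one, Finset.sum_add_distrib, Finset.sum_sub_distrib, h1]
    ring
  rw [edgeSum_pairExp_eq _ ht, hrate]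
  have hμ1 : μ0 t.root ≤ 1 := hμ0_sum ▸ Finset.single_le_sum (fun a _ => hμ0 a) (Finset.mem_univ _)
  have hmr : m t.root ≤ ∑ a, m a := Finset.single_le_sum (fun a _ => hm0 a) (Finset.mem_univ _)
  have hexp : 1 ≤ Real.exp (∑ a, m a) * Real.exp (-(((t.size : ℝ) - 1) * c)) *
      Real.exp (((t.size : ℝ) - 1) * tiltRate Q θ (empPair t) + (1 - m t.root)) := by
    rw [← Real.exp_add, ← Real.exp_add]
    refine Real.one_le_exp ?_
    have := mul_le_mul_of_nonneg_left hc hn.le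
    linarith
  calc μ0 t.root * t.treeProd (fun _ => poissonLaw) Q
      ≤ 1 * t.treeProd (fun _ => poissonLaw) Q := by gcongr
    _ ≤ _ := by
      refine (mul_le_mul_of_nonneg_right hexp hu).trans_eq ?_
      ring

lemma eventMass_tilt_le {μ0 : 𝒳 → ℝ} (hμ0 : ∀ a, 0 ≤ μ0 a) (hμ0_sum : ∑ a, μ0 a = 1)
    {Q : 𝒳 → 𝒳 → ℝ} (hQ : ∀ a b, 0 ≤ Q a b) (θ : 𝒳 × 𝒳 → ℝ) :
    ∃ C : ℝ, 0 < C ∧ ∀ (c : ℝ) (n : ℕ), 2 ≤ n →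
      eventMass (jointWeight poissonLaw μ0 Q) n (pairEvent {μ : PV 𝒳 | c ≤ tiltRate Q θ μ.1}) ≤
        ENNReal.ofReal (C * Real.exp (-(((n : ℝ) - 1) * c))) := by
  have hM : ∀ a b, 0 ≤ Q a b * Real.exp (θ (a, b)) := fun a b =>
    mul_nonneg (hQ a b) (Real.exp_pos _).le
  refine ⟨Real.exp (∑ a, ∑ b, Q a b * Real.exp (θ (a, b))) * (Fintype.card 𝒳 + 1), by positivity,
    fun c n hn => ?_⟩
  set K := Real.exp (∑ a, ∑ b, Q a b * Real.exp (θ (a, b)))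
  set e := Real.exp (-(((n : ℝ) - 1) * c)) with he
  calc _ ≤ ∑' t : PTree 𝒳, ENNReal.ofReal (K * e) * ENNReal.ofReal (t.treeProd
          (fun a m => Real.exp (-∑ b, Q a b * Real.exp (θ (a, b))) / (Nat.factorial m))
          (fun a b => Q a b * Real.exp (θ (a, b)))) := by
        refine ENNReal.tsum_le_tsum fun t => ?_
        split_ifs with ht
        · obtain ⟨rfl, _, hF⟩ := ht
          rw [← ENNReal.ofReal_mul (by positivity)]
          exact ENNReal.ofReal_le_ofReal (jointWeight_le_tilt hμ0 hμ0_sum hQ θ c hn hF)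
        · exact zero_le
    _ ≤ ENNReal.ofReal (K * e) * Fintype.card 𝒳 := by
        rw [ENNReal.tsum_mul_left]
        gcongr
        exact tsum_poisson_treeProd_le hM
    _ ≤ ENNReal.ofReal (K * e) * ENNReal.ofReal (Fintype.card 𝒳 + 1) := by
        gcongr
        rw [← ENNReal.ofReal_natCast]
        exact ENNReal.ofReal_le_ofReal (by linarith)
    _ = _ := by
        rw [← ENNReal.ofReal_mul (by positivity)]
        congr 1
        ring

/-! ### The rate function -/

lemma mul_sub_mul_exp_le {x y : ℝ} (hx : 0 ≤ x) (hy : 0 ≤ y) (hxy : y = 0 → x = 0) (s : ℝ) :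
    x * s - y * Real.exp s ≤ x * Real.log (x / y) - x := by
  rcases hx.eq_or_lt with rfl | hx
  · simpa using mul_nonneg hy (Real.exp_pos s).le
  have hy : 0 < y := hy.lt_of_ne fun h => hx.ne' (hxy h.symm)
  have h1 := Real.add_one_le_exp (s - Real.log (x / y))
  rw [Real.exp_sub, Real.exp_log (div_pos hx hy)] at h1
  have h2 : x * (Real.exp s / (x / y)) = y * Real.exp s := by field_simp
  nlinarith [mul_le_mul_of_nonneg_left h1 hx.le]

lemma exists_le_mul_sub_mul_exp {x y : ℝ} (hx : 0 ≤ x) (hy : 0 ≤ y) (hxy : y = 0 → x = 0)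
    {ε : ℝ} (hε : 0 < ε) :
    ∃ s, x * Real.log (x / y) - x - ε ≤ x * s - y * Real.exp s := by
  rcases hx.eq_or_lt with rfl | hx
  · refine ⟨Real.log (ε / (y + 1)), ?_⟩
    rw [Real.exp_log (by positivity)]
    have : y * (ε / (y + 1)) ≤ ε := by
      rw [mul_div_assoc', div_le_iff₀ (by positivity)]
      nlinarith
    simpa using this
  · have hy : 0 < y := hy.lt_of_ne fun h => hx.ne' (hxy h.symm)
    refine ⟨Real.log (x / y), ?_⟩
    rw [Real.exp_log (div_pos hx hy)]
    have : y * (x / y) = x := by field_simp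
    linarith

lemma cramerRate_poissonLaw {x : ℝ} (hx : 0 ≤ x) :
    cramerRate poissonLaw x = ((1 - x + x * Real.log x : ℝ) : EReal) := by
  have hlog : ∀ s : ℝ, Real.log (∑' n : ℕ, poissonLaw n * Real.exp (s * n)) =
      Real.exp s - 1 := by
    intro s
    have h : ∀ n : ℕ, poissonLaw n * Real.exp (s * n) =
        Real.exp (-1) * (Real.exp s ^ n / (Nat.factorial n)) := fun n => by
      rw [poissonLaw, ← Real.exp_nat_mul, mul_comm s]
      ring
    simp_rw [h]
    rw [tsum_mul_left, ← congrFun NormedSpace.exp_eq_tsum_div, ← Real.exp_eq_exp_ℝ, ← Real.exp_add, Real.log_exp]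
    ring
  simp only [cramerRate, hlog]
  apply le_antisymm
  · refine iSup_le fun s => EReal.coe_le_coe_iff.2 ?_
    have := mul_sub_mul_exp_le hx zero_le_one (fun h => absurd h one_ne_zero) s
    simp only [div_one, one_mul] at this
    linarith
  · refine le_of_forall_lt fun c hc => ?_
    obtain ⟨r, hcr, hr⟩ := EReal.lt_iff_exists_real_btwn.1 hc
    rw [EReal.coe_lt_coe_iff] at hr
    obtain ⟨s, hs⟩ := exists_le_mul_sub_mul_exp hx zero_le_one (fun h => absurd h one_ne_zero)
      (sub_pos.2 hr)
    simp only [div_one, one_mul] at hs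
    refine hcr.trans_le (le_iSup_of_le s (EReal.coe_le_coe_iff.2 ?_))
    linarith

lemma relEnt_of_ac {α : Type*} [Fintype α] {ν ρ : α → ℝ} (hν : ∀ a, 0 ≤ ν a) (hρ : ∀ a, 0 ≤ ρ a)
    (hac : ∀ a, ρ a = 0 → ν a = 0) (hsum : ∑ a, ν a = ∑ a, ρ a) :
    0 ≤ ∑ a, ν a * Real.log (ν a / ρ a) ∧
      relEnt ν ρ = ENNReal.ofReal (∑ a, ν a * Real.log (ν a / ρ a)) := by
  have h0 : ∀ a, 0 ≤ ν a * Real.log (ν a / ρ a) + ρ a - ν a := fun a => by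
    have := mul_sub_mul_exp_le (hν a) (hρ a) (hac a) 0
    simp only [mul_zero, Real.exp_zero, mul_one] at this
    linarith
  have h1 : ∑ a, (ν a * Real.log (ν a / ρ a) + ρ a - ν a) =
      ∑ a, ν a * Real.log (ν a / ρ a) := by
    simp only [Finset.sum_sub_distrib, Finset.sum_add_distrib, hsum]
    ring
  refine ⟨h1 ▸ Finset.sum_nonneg fun a _ => h0 a, ?_⟩
  rw [relEnt, if_pos hac, tsum_fintype, ← ENNReal.ofReal_sum_of_nonneg fun a _ => h0 a, h1]

lemma relEnt_of_not_ac {α : Type*} {ν ρ : α → ℝ} (hac : ¬ ∀ a, ρ a = 0 → ν a = 0) :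
    relEnt ν ρ = ∞ := if_neg hac

/-- The product of the second marginal of `μ` and the kernel `Q`. -/
noncomputable def sndKernel (Q : 𝒳 → 𝒳 → ℝ) (μ : 𝒳 × 𝒳 → ℝ) (x : 𝒳 × 𝒳) : ℝ :=
  (∑ c, μ (c, x.1)) * Q x.1 x.2

lemma sndKernel_nonneg {Q : 𝒳 → 𝒳 → ℝ} (hQ : ∀ a b, 0 ≤ Q a b) {μ : 𝒳 × 𝒳 → ℝ}
    (hμ : IsProbVec μ) (x : 𝒳 × 𝒳) : 0 ≤ sndKernel Q μ x :=
  mul_nonneg (Finset.sum_nonneg fun _ _ => hμ.1 _) (hQ _ _)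

lemma sum_sndKernel {Q : 𝒳 → 𝒳 → ℝ} (hQ_sum : ∀ a, ∑ b, Q a b = 1) {μ : 𝒳 × 𝒳 → ℝ}
    (hμ : IsProbVec μ) : ∑ x, sndKernel Q μ x = 1 := by
  rw [Fintype.sum_prod_type]
  simp only [sndKernel, ← Finset.mul_sum, hQ_sum, mul_one]
  rw [← hμ.2, Fintype.sum_prod_type_right]

/-- The chain rule `H(μ ‖ μ₁ ⊗ Q) + H(μ₁ ‖ μ₂) = H(μ ‖ μ₂ ⊗ Q)`. -/
lemma ratePoisson_eq_relEnt {Q : 𝒳 → 𝒳 → ℝ} (hQ : ∀ a b, 0 ≤ Q a b)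
    (hQ_sum : ∀ a, ∑ b, Q a b = 1) {μ : 𝒳 × 𝒳 → ℝ} (hμ : IsProbVec μ) :
    ratePoisson Q μ = relEnt μ (sndKernel Q μ) := by
  set μ1 : 𝒳 → ℝ := fun a => ∑ b, μ (a, b) with hμ1
  set μ2 : 𝒳 → ℝ := fun b => ∑ a, μ (a, b) with hμ2
  have h1 : ∀ a, 0 ≤ μ1 a := fun a => Finset.sum_nonneg fun b _ => hμ.1 _
  have h2 : ∀ a, 0 ≤ μ2 a := fun a => Finset.sum_nonneg fun b _ => hμ.1 _
  have hle : ∀ a b, μ (a, b) ≤ μ1 a := fun a b =>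
    Finset.single_le_sum (f := fun b => μ (a, b)) (fun b _ => hμ.1 _) (Finset.mem_univ b)
  have hrate : ratePoisson Q μ =
      ((relEnt μ (fun x => μ1 x.1 * Q x.1 x.2) + relEnt μ1 μ2 : ℝ≥0∞) : EReal) :=
    (EReal.coe_ennreal_add _ _).symm
  rw [hrate]
  congr 1
  by_cases hac : ∀ x, sndKernel Q μ x = 0 → μ x = 0
  · have hac1 : ∀ x : 𝒳 × 𝒳, μ1 x.1 * Q x.1 x.2 = 0 → μ x = 0 := by
      intro x hx
      rcases mul_eq_zero.1 hx with h | h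
      · exact le_antisymm (h ▸ hle x.1 x.2) (hμ.1 x)
      · exact hac x (by rw [sndKernel, h, mul_zero])
    have hac2 : ∀ a, μ2 a = 0 → μ1 a = 0 := fun a ha =>
      Finset.sum_eq_zero fun b _ => hac (a, b) (mul_eq_zero_of_left ha _)
    have hs1 : ∑ a, μ1 a = 1 := by rw [← hμ.2, Fintype.sum_prod_type]
    have hs2 : ∑ a, μ2 a = 1 := by rw [← hμ.2, Fintype.sum_prod_type_right]
    have hs : ∑ x : 𝒳 × 𝒳, μ1 x.1 * Q x.1 x.2 = 1 := by
      rw [Fintype.sum_prod_type]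
      simp only [← Finset.mul_sum, hQ_sum, mul_one, hs1]
    obtain ⟨p1, e1⟩ := relEnt_of_ac hμ.1 (fun x : 𝒳 × 𝒳 => mul_nonneg (h1 x.1) (hQ x.1 x.2)) hac1
      (hμ.2.trans hs.symm)
    obtain ⟨p2, e2⟩ := relEnt_of_ac h1 h2 hac2 (hs1.trans hs2.symm)
    rw [e1, e2, (relEnt_of_ac hμ.1 (sndKernel_nonneg hQ hμ) hac
      (hμ.2.trans (sum_sndKernel hQ_sum hμ).symm)).2, ← ENNReal.ofReal_add p1 p2]
    congr 1
    have h3 : ∑ a, μ1 a * Real.log (μ1 a / μ2 a) =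
        ∑ x : 𝒳 × 𝒳, μ x * Real.log (μ1 x.1 / μ2 x.1) := by
      rw [Fintype.sum_prod_type]
      simp only [← Finset.sum_mul, hμ1]
    rw [h3, ← Finset.sum_add_distrib]
    refine Finset.sum_congr rfl fun x _ => ?_
    rcases (hμ.1 x).eq_or_lt with h | h
    · simp [← h]
    have hs0 : sndKernel Q μ x ≠ 0 := fun h' => h.ne' (hac x h')
    have hQ0 : Q x.1 x.2 ≠ 0 := right_ne_zero_of_mul hs0
    have h20 : μ2 x.1 ≠ 0 := left_ne_zero_of_mul hs0
    have h10 : μ1 x.1 ≠ 0 := fun h' => h.ne' (hac1 x (by rw [h', zero_mul]))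
    rw [← mul_add, ← Real.log_mul (by positivity) (by positivity)]
    congr 2
    change _ = μ x / (μ2 x.1 * Q x.1 x.2)
    field_simp
  · rw [relEnt_of_not_ac hac]
    by_contra hne
    have hfin := ENNReal.add_ne_top.1 hne
    refine hac fun x hx => ?_
    have hac1 := not_not.1 fun h => hfin.1 (relEnt_of_not_ac h)
    have hac2 := not_not.1 fun h => hfin.2 (relEnt_of_not_ac h)
    rcases mul_eq_zero.1 hx with h | h
    · exact hac1 x (by rw [hac2 _ h, zero_mul])
    · exact hac1 x (by rw [h, mul_zero])

lemma ratePoisson_of_ac {Q : 𝒳 → 𝒳 → ℝ} (hQ : ∀ a b, 0 ≤ Q a b)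
    (hQ_sum : ∀ a, ∑ b, Q a b = 1) {μ : 𝒳 × 𝒳 → ℝ} (hμ : IsProbVec μ)
    (hac : ∀ x, sndKernel Q μ x = 0 → μ x = 0) :
    ratePoisson Q μ = ((∑ x, μ x * Real.log (μ x / sndKernel Q μ x) : ℝ) : EReal) := by
  obtain ⟨h0, h⟩ := relEnt_of_ac hμ.1 (sndKernel_nonneg hQ hμ) hac
    (hμ.2.trans (sum_sndKernel hQ_sum hμ).symm)
  rw [ratePoisson_eq_relEnt hQ hQ_sum hμ, h, EReal.coe_ennreal_ofReal, max_eq_left h0]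

lemma ratePoisson_of_not_ac {Q : 𝒳 → 𝒳 → ℝ} (hQ : ∀ a b, 0 ≤ Q a b)
    (hQ_sum : ∀ a, ∑ b, Q a b = 1) {μ : 𝒳 × 𝒳 → ℝ} (hμ : IsProbVec μ)
    (hac : ¬ ∀ x, sndKernel Q μ x = 0 → μ x = 0) : ratePoisson Q μ = ⊤ := by
  rw [ratePoisson_eq_relEnt hQ hQ_sum hμ, relEnt_of_not_ac hac, EReal.coe_ennreal_top]

lemma tiltRate_eq (Q : 𝒳 → 𝒳 → ℝ) (θ μ : 𝒳 × 𝒳 → ℝ) :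
    tiltRate Q θ μ = ∑ x, (μ x * θ x - sndKernel Q μ x * Real.exp (θ x)) + 1 := by
  simp only [tiltRate, sndKernel, Finset.sum_sub_distrib, mul_assoc]
  ring

/-- The variational formula for the rate function. -/
lemma ratePoisson_eq_iSup {Q : 𝒳 → 𝒳 → ℝ} (hQ : ∀ a b, 0 ≤ Q a b)
    (hQ_sum : ∀ a, ∑ b, Q a b = 1) {μ : 𝒳 × 𝒳 → ℝ} (hμ : IsProbVec μ) :
    ratePoisson Q μ = ⨆ θ : 𝒳 × 𝒳 → ℝ, ((tiltRate Q θ μ : ℝ) : EReal) := by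
  have hs := sndKernel_nonneg hQ hμ
  by_cases hac : ∀ x, sndKernel Q μ x = 0 → μ x = 0
  · rw [ratePoisson_of_ac hQ hQ_sum hμ hac]
    have hR : ∑ x, (μ x * Real.log (μ x / sndKernel Q μ x) - μ x) + 1 =
        ∑ x, μ x * Real.log (μ x / sndKernel Q μ x) := by
      rw [Finset.sum_sub_distrib, hμ.2]
      ring
    apply le_antisymm
    · refine le_of_forall_lt fun c hc => ?_
      obtain ⟨r, hcr, hr⟩ := EReal.lt_iff_exists_real_btwn.1 hc
      rw [EReal.coe_lt_coe_iff, ← sub_pos] at hr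
      set d := ∑ x, μ x * Real.log (μ x / sndKernel Q μ x) - r with hd
      have hε : 0 < d / (Fintype.card (𝒳 × 𝒳) + 1) := by positivity
      choose θ hθ using fun x => exists_le_mul_sub_mul_exp (hμ.1 x) (hs x) (hac x) hε
      refine hcr.trans_le (le_iSup_of_le θ (EReal.coe_le_coe_iff.2 ?_))
      have h1 := Finset.sum_le_sum fun x (_ : x ∈ Finset.univ) => hθ x
      rw [Finset.sum_sub_distrib, Finset.sum_const, Finset.card_univ, nsmul_eq_mul] at h1
      have h2 : (Fintype.card (𝒳 × 𝒳) : ℝ) * (d / (Fintype.card (𝒳 × 𝒳) + 1)) ≤ d := by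
        rw [mul_div_assoc', div_le_iff₀ (by positivity)]
        nlinarith
      rw [tiltRate_eq]
      linarith
    · refine iSup_le fun θ => EReal.coe_le_coe_iff.2 ?_
      rw [tiltRate_eq, ← hR]
      refine add_le_add_left (Finset.sum_le_sum fun x _ => ?_) 1
      exact mul_sub_mul_exp_le (hμ.1 x) (hs x) (hac x) _
  · rw [ratePoisson_of_not_ac hQ hQ_sum hμ hac, eq_comm, EReal.eq_top_iff_forall_lt]
    intro c
    push Not at hac
    obtain ⟨x, hx, hx0⟩ := hac
    have hx0 : 0 < μ x := (hμ.1 x).lt_of_ne hx0.symm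
    refine lt_of_lt_of_le ?_ (le_iSup _ (Pi.single x ((|c| + 1) / μ x)))
    rw [EReal.coe_lt_coe_iff, tiltRate_eq, Finset.sum_sub_distrib]
    have h1 : ∑ y, μ y * Pi.single (M := fun _ => ℝ) x ((|c| + 1) / μ x) y = |c| + 1 := by
      rw [Finset.sum_eq_single x]
      · rw [Pi.single_eq_same]
        field_simp
      · intro y _ hy
        rw [Pi.single_eq_of_ne hy, mul_zero]
      · simp
    have h2 : ∑ y, sndKernel Q μ y * Real.exp (Pi.single (M := fun _ => ℝ) x ((|c| + 1) / μ x) y)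
        = 1 := by
      rw [← sum_sndKernel hQ_sum hμ]
      refine Finset.sum_congr rfl fun y _ => ?_
      by_cases hy : y = x
      · rw [hy, hx, zero_mul]
      · rw [Pi.single_eq_of_ne hy, Real.exp_zero, mul_one]
    rw [h1, h2]
    linarith [le_abs_self c]

lemma lowerSemicontinuous_ratePoisson {Q : 𝒳 → 𝒳 → ℝ} (hQ : ∀ a b, 0 ≤ Q a b)
    (hQ_sum : ∀ a, ∑ b, Q a b = 1) :
    LowerSemicontinuous fun μ : PV 𝒳 => ratePoisson Q μ.1 := by
  simp_rw [fun μ : PV 𝒳 => ratePoisson_eq_iSup hQ hQ_sum μ.2]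
  refine lowerSemicontinuous_iSup fun θ => Continuous.lowerSemicontinuous ?_
  exact continuous_coe_real_ereal.comp ((continuous_tiltRate Q θ).comp continuous_subtype_val)

instance compactSpace_PV : CompactSpace (PV 𝒳) := by
  have h : {μ : 𝒳 × 𝒳 → ℝ | IsProbVec μ} = stdSimplex ℝ (𝒳 × 𝒳) := rfl
  exact isCompact_iff_compactSpace.1 (h.symm ▸ isCompact_stdSimplex ℝ (𝒳 × 𝒳) :
    IsCompact {μ : 𝒳 × 𝒳 → ℝ | IsProbVec μ})

/-! ### Generating polynomials of typed trees -/

/-- The algebraic preorder of a commutative semiring. -/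
def AddLE {R : Type*} [CommSemiring R] (f g : R) : Prop := ∃ d, g = f + d

namespace AddLE

variable {R : Type*} [CommSemiring R] {f g f' g' k : R}

lemma refl (f : R) : AddLE f f := ⟨0, (add_zero f).symm⟩

lemma zero_left (f : R) : AddLE 0 f := ⟨f, (zero_add f).symm⟩

lemma trans (h : AddLE f g) (h' : AddLE g k) : AddLE f k := by
  obtain ⟨d, rfl⟩ := h
  obtain ⟨e, rfl⟩ := h'
  exact ⟨d + e, add_assoc _ _ _⟩

lemma add (h : AddLE f g) (h' : AddLE f' g') : AddLE (f + f') (g + g') := by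
  obtain ⟨d, rfl⟩ := h
  obtain ⟨e, rfl⟩ := h'
  exact ⟨d + e, add_add_add_comm _ _ _ _⟩

lemma mul (h : AddLE f g) (h' : AddLE f' g') : AddLE (f * f') (g * g') := by
  obtain ⟨d, rfl⟩ := h
  obtain ⟨e, rfl⟩ := h'
  exact ⟨f * e + d * f' + d * e, by ring⟩

lemma pow (h : AddLE f g) (n : ℕ) : AddLE (f ^ n) (g ^ n) := by
  induction n with
  | zero => simpa using refl 1
  | succ n ih => simpa only [pow_succ] using ih.mul h

lemma sum {ι : Type*} {s : Finset ι} {u v : ι → R} (h : ∀ i ∈ s, AddLE (u i) (v i)) :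
    AddLE (∑ i ∈ s, u i) (∑ i ∈ s, v i) := by
  classical
  induction s using Finset.induction_on with
  | empty => simpa using refl 0
  | insert i s hi ih =>
    rw [Finset.sum_insert hi, Finset.sum_insert hi]
    exact (h i (Finset.mem_insert_self i s)).add
      (ih fun j hj => h j (Finset.mem_insert_of_mem hj))

lemma prod {ι : Type*} {s : Finset ι} {u v : ι → R} (h : ∀ i ∈ s, AddLE (u i) (v i)) :
    AddLE (∏ i ∈ s, u i) (∏ i ∈ s, v i) := by
  classical
  induction s using Finset.induction_on with
  | empty => simpa using refl 1
  | insert i s hi ih =>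
    rw [Finset.prod_insert hi, Finset.prod_insert hi]
    exact (h i (Finset.mem_insert_self i s)).mul
      (ih fun j hj => h j (Finset.mem_insert_of_mem hj))

lemma sum_subset {ι : Type*} [DecidableEq ι] {s t : Finset ι} (h : s ⊆ t) (u : ι → R) :
    AddLE (∑ i ∈ s, u i) (∑ i ∈ t, u i) :=
  ⟨∑ i ∈ t \ s, u i, by rw [add_comm, Finset.sum_sdiff h]⟩

lemma single_le_sum {ι : Type*} [DecidableEq ι] {s : Finset ι} {i : ι} (h : i ∈ s) (u : ι → R) :
    AddLE (u i) (∑ j ∈ s, u j) := by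
  simpa using sum_subset (Finset.singleton_subset_iff.2 h) u

end AddLE

section Exponential

variable {σ : Type*}

open MvPolynomial

lemma nnreal_add_one_pow_div_factorial (k m : ℕ) :
    ((k : ℝ≥0) + 1) ^ m / (Nat.factorial m) =
      ∑ i ∈ Finset.range (m + 1),
        (k : ℝ≥0) ^ i / (Nat.factorial i) * (1 / (Nat.factorial (m - i))) := by
  rw [add_pow, Finset.sum_div]
  refine Finset.sum_congr rfl fun i hi => ?_
  have h := Nat.choose_mul_factorial_mul_factorial (Nat.lt_succ_iff.1 (Finset.mem_range.1 hi))
  have h' : (m.choose i : ℝ≥0) * (Nat.factorial i) * (Nat.factorial (m - i)) = Nat.factorial m := by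
    exact_mod_cast h
  have h1 : (Nat.factorial i : ℝ≥0) ≠ 0 := by exact_mod_cast Nat.factorial_ne_zero i
  have h2 : (Nat.factorial (m - i) : ℝ≥0) ≠ 0 := by exact_mod_cast Nat.factorial_ne_zero _
  have h3 : (Nat.factorial m : ℝ≥0) ≠ 0 := by exact_mod_cast Nat.factorial_ne_zero m
  rw [one_pow, mul_one, div_mul_div_comm, mul_one, div_eq_div_iff h3 (mul_ne_zero h1 h2), ← h']
  ring

/-- A power of a truncated exponential series dominates the truncated series of the power. -/
lemma addLE_truncated_exp_pow (e : ℝ≥0) (y : MvPolynomial σ ℝ≥0) (n k : ℕ) :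
    AddLE (∑ i ∈ Finset.range n, C (e ^ k * ((k : ℝ≥0) ^ i / (Nat.factorial i))) * y ^ i)
      ((∑ i ∈ Finset.range n, C (e / (Nat.factorial i)) * y ^ i) ^ k) := by
  induction k with
  | zero =>
    rcases n with _ | n
    · simpa using AddLE.zero_left 1
    · rw [Finset.sum_eq_single 0]
      · simpa using AddLE.refl 1
      · intro i _ hi
        simp [hi]
      · simp
  | succ k ih =>
    rw [pow_succ (∑ i ∈ Finset.range n, C (e / (Nat.factorial i)) * y ^ i)]
    refine AddLE.trans ?_ (ih.mul (AddLE.refl _))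
    set F : ℕ → ℕ → MvPolynomial σ ℝ≥0 := fun i j =>
      C (e ^ k * ((k : ℝ≥0) ^ i / (Nat.factorial i))) * y ^ i *
        (C (e / (Nat.factorial j)) * y ^ j) with hF
    have h1 : ∑ i ∈ Finset.range n,
          C (e ^ (k + 1) * (((k + 1 : ℕ) : ℝ≥0) ^ i / (Nat.factorial i))) * y ^ i =
        ∑ m ∈ Finset.range n, ∑ i ∈ Finset.range (m + 1), F i (m - i) := by
      refine Finset.sum_congr rfl fun m _ => ?_
      rw [Nat.cast_succ, nnreal_add_one_pow_div_factorial, Finset.mul_sum, map_sum,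
        Finset.sum_mul]
      refine Finset.sum_congr rfl fun i hi => ?_
      have him : i + (m - i) = m := by
        have := Finset.mem_range.1 hi
        omega
      rw [hF]
      simp only
      rw [mul_mul_mul_comm, ← C_mul, ← pow_add, him]
      congr 2
      ring
    rw [h1, Finset.sum_range_diag_flip, Finset.sum_mul_sum]
    refine AddLE.sum fun i _ => AddLE.sum_subset ?_ _
    exact Finset.range_subset_range.2 (Nat.sub_le n i)

lemma addLE_truncated_exp_pow_multinomial {ι : Type*} [Fintype ι] [DecidableEq ι] (e : ℝ≥0)
    (q : ι → ℝ≥0) (Z : ι → MvPolynomial σ ℝ≥0) (k n : ℕ) (c : ι → ℕ) (hc : ∑ b, c b < n) :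
    AddLE (C (e ^ k * ∏ b, ((k * q b) ^ c b / (Nat.factorial (c b)))) * ∏ b, Z b ^ c b)
      ((∑ i ∈ Finset.range n, C (e / (Nat.factorial i)) * (∑ b, C (q b) * Z b) ^ i) ^ k) := by
  refine AddLE.trans ?_ (addLE_truncated_exp_pow e _ n k)
  refine AddLE.trans ?_ (AddLE.single_le_sum (Finset.mem_range.2 hc) _)
  rw [Finset.sum_pow_eq_sum_piAntidiag]
  refine AddLE.trans ?_ ((AddLE.refl _).mul (AddLE.single_le_sum
    (Finset.mem_piAntidiag.2 ⟨rfl, fun b _ => Finset.mem_univ b⟩ :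
      c ∈ Finset.piAntidiag Finset.univ (∑ b, c b)) _))
  have hm : (∏ b, (Nat.factorial (c b) : ℝ≥0)) * (Nat.multinomial Finset.univ c : ℝ≥0) =
      Nat.factorial (∑ b, c b) := by
    exact_mod_cast Nat.multinomial_spec Finset.univ c
  have h1 : (∏ b, (Nat.factorial (c b) : ℝ≥0)) ≠ 0 :=
    Finset.prod_ne_zero_iff.2 fun b _ => by exact_mod_cast Nat.factorial_ne_zero _
  have h2 : (Nat.factorial (∑ b, c b) : ℝ≥0) ≠ 0 := by exact_mod_cast Nat.factorial_ne_zero _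
  have hcoef : e ^ k * ∏ b, ((k * q b) ^ c b / (Nat.factorial (c b) : ℝ≥0)) =
      e ^ k * ((k : ℝ≥0) ^ (∑ b, c b) / (Nat.factorial (∑ b, c b))) *
        ((Nat.multinomial Finset.univ c : ℝ≥0) * ∏ b, q b ^ c b) := by
    rw [Finset.prod_div_distrib, mul_assoc]
    congr 1
    simp only [mul_pow, Finset.prod_mul_distrib, Finset.prod_pow_eq_pow_sum]
    rw [div_mul_eq_mul_div, div_eq_div_iff h1 h2, ← hm]
    ring
  rw [hcoef]
  convert AddLE.refl _ using 1
  simp only [mul_pow, Finset.prod_mul_distrib, C_mul, map_prod, C_pow, map_natCast]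
  ring

end Exponential

section Production

open MvPolynomial

/-- The generating polynomial, in the pair counts, of the trees of bounded height and degree with
root type `a`. -/
noncomputable def treePoly (e : ℝ≥0) (q : 𝒳 → 𝒳 → ℝ≥0) (h : ℕ) (a : 𝒳) :
    MvPolynomial (𝒳 × 𝒳) ℝ≥0 :=
  ∑ t ∈ boundedTrees h a,
    t.treeProd (fun _ m => C (e / (Nat.factorial m))) (fun a b => C (q a b) * X (a, b))

variable {e : ℝ≥0} {q : 𝒳 → 𝒳 → ℝ≥0}

lemma PTree.treeProd_eq_monomial (e : ℝ≥0) (q : 𝒳 → 𝒳 → ℝ≥0) (t : PTree 𝒳) :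
    t.treeProd (fun _ m => C (e / (Nat.factorial m))) (fun a b => C (q a b) * X (a, b)) =
      monomial (pairExp t) (t.treeProd (fun _ m => e / (Nat.factorial m)) q) := by
  induction t using PTree.induction_children with
  | H a ts ih =>
    rw [treeProd_node, treeProd_node, pairExp_node, ← C_mul_monomial]
    congr 1
    have h : ∀ l : List (PTree 𝒳), monomial (l.map fun c => Finsupp.single (a, c.root) 1 +
          pairExp c).sum (l.map fun c => q a c.root *
            c.treeProd (fun _ m => e / (Nat.factorial m)) q).prod =
        (l.map fun c => C (q a c.root) * X (a, c.root) * monomial (pairExp c)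
          (c.treeProd (fun _ m => e / (Nat.factorial m)) q)).prod := by
      intro l
      induction l with
      | nil => simp
      | cons c l ihl =>
        rw [List.map_cons, List.map_cons, List.map_cons, List.sum_cons, List.prod_cons,
          List.prod_cons, ← ihl, C_mul_X_eq_monomial, monomial_mul, monomial_mul]
    rw [h]
    congr 1
    exact List.map_congr_left fun c hc => by rw [ih c hc]

lemma treePoly_succ (e : ℝ≥0) (q : 𝒳 → 𝒳 → ℝ≥0) (h : ℕ) (a : 𝒳) :
    treePoly e q (h + 1) a = ∑ m ∈ Finset.range (h + 1), C (e / (Nat.factorial m)) *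
      (∑ b, C (q a b) * (X (a, b) * treePoly e q h b)) ^ m := by
  simp only [treePoly, sum_boundedTrees_succ, mul_assoc]

lemma treePoly_mono (e : ℝ≥0) (q : 𝒳 → 𝒳 → ℝ≥0) {h h' : ℕ} (hh : h ≤ h') (a : 𝒳) :
    AddLE (treePoly e q h a) (treePoly e q h' a) := by
  classical
  exact AddLE.sum_subset (boundedTrees_mono a hh) _

/-- The generating polynomial of a forest with `v a` roots of type `a`. -/
noncomputable def popPoly (e : ℝ≥0) (q : 𝒳 → 𝒳 → ℝ≥0) (v : 𝒳 → ℕ) (h : ℕ) :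
    MvPolynomial (𝒳 × 𝒳) ℝ≥0 :=
  ∏ a, treePoly e q h a ^ v a

lemma popPoly_add (v w : 𝒳 → ℕ) (h : ℕ) :
    popPoly e q (v + w) h = popPoly e q v h * popPoly e q w h := by
  simp only [popPoly, Pi.add_apply, pow_add, Finset.prod_mul_distrib]

lemma popPoly_zero (h : ℕ) : popPoly e q 0 h = 1 := by
  simp [popPoly]

lemma popPoly_single (a : 𝒳) (k h : ℕ) :
    popPoly e q (Pi.single a k) h = treePoly e q h a ^ k := by
  rw [popPoly, Finset.prod_eq_single a]
  · simp
  · intro b _ hb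
    simp [Pi.single_eq_of_ne hb]
  · simp

lemma popPoly_mono (v : 𝒳 → ℕ) {h h' : ℕ} (hh : h ≤ h') :
    AddLE (popPoly e q v h) (popPoly e q v h') :=
  AddLE.prod fun a _ => (treePoly_mono e q hh a).pow _

/-- A population `v` can evolve into the population `v'` with pair counts `N`, with weight at
least `c`. -/
def Produces (e : ℝ≥0) (q : 𝒳 → 𝒳 → ℝ≥0) (c : ℝ≥0) (N : 𝒳 × 𝒳 →₀ ℕ) (v v' : 𝒳 → ℕ) : Prop :=
  ∃ j h0, ∀ h, h0 ≤ h → AddLE (monomial N c * popPoly e q v' h) (popPoly e q v (h + j))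

namespace Produces

variable {c c' : ℝ≥0} {N N' : 𝒳 × 𝒳 →₀ ℕ} {v v' v'' w w' : 𝒳 → ℕ}

lemma refl (v : 𝒳 → ℕ) : Produces e q 1 0 v v :=
  ⟨0, 0, fun h _ => by simpa using AddLE.refl _⟩

lemma trans (H : Produces e q c N v v') (H' : Produces e q c' N' v' v'') :
    Produces e q (c * c') (N + N') v v'' := by
  obtain ⟨j, h0, H⟩ := H
  obtain ⟨j', h0', H'⟩ := H'
  refine ⟨j' + j, max h0 h0', fun h hh => ?_⟩
  rw [← monomial_mul, mul_assoc, ← add_assoc]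
  exact ((AddLE.refl _).mul (H' h (le_trans (le_max_right _ _) hh))).trans
    (H (h + j') (le_trans (le_trans (le_max_left _ _) hh) (Nat.le_add_right _ _)))

lemma add (H : Produces e q c N v v') (H' : Produces e q c' N' w w') :
    Produces e q (c * c') (N + N') (v + w) (v' + w') := by
  obtain ⟨j, h0, H⟩ := H
  obtain ⟨j', h0', H'⟩ := H'
  refine ⟨j + j', max h0 h0', fun h hh => ?_⟩
  rw [← monomial_mul, popPoly_add, popPoly_add, mul_mul_mul_comm]
  exact ((H h (le_trans (le_max_left _ _) hh)).trans (popPoly_mono _ (by omega))).mul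
    ((H' h (le_trans (le_max_right _ _) hh)).trans (popPoly_mono _ (by omega)))

lemma sum {ι : Type*} (s : Finset ι) {c : ι → ℝ≥0} {N : ι → 𝒳 × 𝒳 →₀ ℕ} {v v' : ι → 𝒳 → ℕ}
    (H : ∀ i ∈ s, Produces e q (c i) (N i) (v i) (v' i)) :
    Produces e q (∏ i ∈ s, c i) (∑ i ∈ s, N i) (∑ i ∈ s, v i) (∑ i ∈ s, v' i) := by
  classical
  induction s using Finset.induction_on with
  | empty => simpa using refl 0
  | insert i s hi ih =>
    rw [Finset.prod_insert hi, Finset.sum_insert hi, Finset.sum_insert hi, Finset.sum_insert hi]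
    exact (H i (Finset.mem_insert_self i s)).add
      (ih fun j hj => H j (Finset.mem_insert_of_mem hj))

lemma iterate (H : Produces e q c N v v) (L : ℕ) : Produces e q (c ^ L) (L • N) v v := by
  induction L with
  | zero => simpa using refl v
  | succ L ih => simpa only [pow_succ, succ_nsmul] using ih.trans H

/-- `k` individuals of type `a` give birth to `c b` children of type `b`. -/
lemma row (e : ℝ≥0) (q : 𝒳 → 𝒳 → ℝ≥0) (a : 𝒳) (k : ℕ) (c : 𝒳 → ℕ) :
    Produces e q (e ^ k * ∏ b, ((k * q a b) ^ c b / (Nat.factorial (c b))))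
      (∑ b, Finsupp.single (a, b) (c b)) (Pi.single a k) c := by
  refine ⟨1, ∑ b, c b, fun h hh => ?_⟩
  rw [popPoly_single, treePoly_succ]
  refine AddLE.trans ?_ (addLE_truncated_exp_pow_multinomial e (q a)
    (fun b => X (a, b) * treePoly e q h b) k (h + 1) c (Nat.lt_succ_of_le hh))
  convert AddLE.refl _ using 1
  simp only [mul_pow, Finset.prod_mul_distrib]
  rw [← mul_assoc, popPoly]
  congr 1
  simp only [X_pow_eq_monomial]
  rw [← monomial_sum_one, C_mul_monomial, mul_one]

lemma kill (e : ℝ≥0) (q : 𝒳 → 𝒳 → ℝ≥0) (a : 𝒳) (k : ℕ) :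
    Produces e q (e ^ k) 0 (Pi.single a k) 0 := by
  simpa using row e q a k 0

end Produces

/-- The weight of the production of one generation in which `N (a, b)` children of type `b` are
born from the `∑ c, N (c, a)` individuals of type `a`. -/
noncomputable def blockWeight (e : ℝ≥0) (q : 𝒳 → 𝒳 → ℝ≥0) (N : 𝒳 × 𝒳 →₀ ℕ) : ℝ≥0 :=
  ∏ a, (e ^ (∑ c, N (c, a)) *
    ∏ b, ((((∑ c, N (c, a) : ℕ) : ℝ≥0) * q a b) ^ N (a, b) / (Nat.factorial (N (a, b)))))

lemma produces_block (e : ℝ≥0) (q : 𝒳 → 𝒳 → ℝ≥0) (N : 𝒳 × 𝒳 →₀ ℕ) :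
    Produces e q (blockWeight e q N) N (fun b => ∑ a, N (a, b)) (fun b => ∑ a, N (a, b)) := by
  have H := Produces.sum Finset.univ fun a _ =>
    Produces.row e q a (∑ c, N (c, a)) (fun b => N (a, b))
  have h1 : ∑ a, ∑ b, Finsupp.single (a, b) (N (a, b)) = N := by
    rw [← Fintype.sum_prod_type' (f := fun a b => Finsupp.single (a, b) (N (a, b)))]
    exact Finsupp.univ_sum_single N
  have h2 : ∑ a, Pi.single a (∑ c, N (c, a)) = fun b => ∑ a, N (a, b) :=
    Finset.univ_sum_single fun b => ∑ a, N (a, b)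
  have h3 : (∑ a, fun b => N (a, b)) = fun b => ∑ a, N (a, b) := by
    ext b
    simp
  rwa [h1, h2, h3] at H

/-- A population can evolve into another one with positive weight. -/
def CanProduce (e : ℝ≥0) (q : 𝒳 → 𝒳 → ℝ≥0) (v v' : 𝒳 → ℕ) : Prop :=
  ∃ c > 0, ∃ N, Produces e q c N v v'

namespace CanProduce

variable {v v' v'' w w' : 𝒳 → ℕ}

lemma refl (v : 𝒳 → ℕ) : CanProduce e q v v := ⟨1, one_pos, 0, Produces.refl v⟩

lemma trans (H : CanProduce e q v v') (H' : CanProduce e q v' v'') : CanProduce e q v v'' := by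
  obtain ⟨c, hc, N, H⟩ := H
  obtain ⟨c', hc', N', H'⟩ := H'
  exact ⟨_, mul_pos hc hc', _, H.trans H'⟩

lemma add (H : CanProduce e q v v') (H' : CanProduce e q w w') :
    CanProduce e q (v + w) (v' + w') := by
  obtain ⟨c, hc, N, H⟩ := H
  obtain ⟨c', hc', N', H'⟩ := H'
  exact ⟨_, mul_pos hc hc', _, H.add H'⟩

lemma sum {ι : Type*} (s : Finset ι) {v v' : ι → 𝒳 → ℕ} (H : ∀ i ∈ s, CanProduce e q (v i) (v' i)) :
    CanProduce e q (∑ i ∈ s, v i) (∑ i ∈ s, v' i) := by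
  choose! c hc N hN using H
  exact ⟨_, Finset.prod_pos hc, _, Produces.sum s hN⟩

lemma edge_weight_pos (he : 0 < e) {a b : 𝒳} (hab : 0 < q a b) (K : ℕ) :
    0 < e ^ 1 * ∏ b', ((((1 : ℕ) : ℝ≥0) * q a b') ^ (Pi.single b K : 𝒳 → ℕ) b' /
      (Nat.factorial ((Pi.single b K : 𝒳 → ℕ) b'))) := by
  refine mul_pos (pow_pos he 1) (Finset.prod_pos fun b' _ => ?_)
  refine div_pos ?_ (by exact_mod_cast Nat.factorial_pos _)
  rcases eq_or_ne b' b with rfl | hb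
  · exact pow_pos (by simpa using hab) _
  · simp [Pi.single_eq_of_ne hb]

lemma edge (he : 0 < e) {a b : 𝒳} (hab : 0 < q a b) (K : ℕ) :
    CanProduce e q (Pi.single a 1) (Pi.single b K) :=
  ⟨_, edge_weight_pos he hab K, _, Produces.row e q a 1 (Pi.single b K)⟩

lemma path (he : 0 < e) {a b : 𝒳} (hab : Relation.TransGen (fun a b => 0 < q a b) a b) (K : ℕ) :
    CanProduce e q (Pi.single a 1) (Pi.single b K) := by
  induction hab generalizing K with
  | single h => exact edge he h K
  | tail _ h ih => exact (ih 1).trans (edge he h K)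

lemma grow (he : 0 < e) (hq : ∀ a b, Relation.TransGen (fun a b => 0 < q a b) a b) (r : 𝒳)
    (k : 𝒳 → ℕ) : CanProduce e q (Pi.single r 1) (k + Pi.single r 1) := by
  have h1 : (Pi.single r (Fintype.card 𝒳 + 1) : 𝒳 → ℕ) =
      ∑ _b : 𝒳, (Pi.single r 1 : 𝒳 → ℕ) + Pi.single r 1 := by
    rw [Pi.single_add, Finset.sum_const, Finset.card_univ, ← Pi.single_smul]
    simp
  refine (path he (hq r r) (Fintype.card 𝒳 + 1)).trans ?_
  rw [h1]
  refine CanProduce.add ?_ (refl _)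
  have h2 := CanProduce.sum (e := e) (q := q) Finset.univ fun b _ => path he (hq r b) (k b)
  rwa [Finset.univ_sum_single] at h2

end CanProduce

lemma exists_produces_zero_of_edgeSum (he : 0 < e) {r b : 𝒳} (hb : 0 < q r b) (j : ℕ) :
    ∃ c > 0, ∃ N, edgeSum (1 : 𝒳 × 𝒳 → ℕ) N = j ∧ Produces e q c N (Pi.single r 1) 0 := by
  refine ⟨_, mul_pos (CanProduce.edge_weight_pos he hb j) (pow_pos he j), _, ?_,
    (Produces.row e q r 1 (Pi.single b j)).trans (Produces.kill e q b j)⟩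
  rw [add_zero, map_sum]
  simp [edgeSum_single]

lemma exists_produces_zero (e : ℝ≥0) (q : 𝒳 → 𝒳 → ℝ≥0) (he : 0 < e) (v : 𝒳 → ℕ) :
    ∃ c > 0, Produces e q c 0 v 0 := by
  have H := Produces.sum Finset.univ fun a _ => Produces.kill e q a (v a)
  rw [Finset.univ_sum_single] at H
  exact ⟨_, Finset.prod_pos fun a _ => pow_pos he (v a), by simpa using H⟩

lemma Produces.exists_le_coeff {c : ℝ≥0} {N : 𝒳 × 𝒳 →₀ ℕ} {r : 𝒳}
    (H : Produces e q c N (Pi.single r 1) 0) : ∃ h, c ≤ coeff N (treePoly e q h r) := by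
  obtain ⟨j, h0, H⟩ := H
  obtain ⟨d, hd⟩ := H h0 le_rfl
  refine ⟨h0 + j, ?_⟩
  rw [popPoly_single, pow_one, popPoly_zero, mul_one] at hd
  rw [hd, coeff_add, coeff_monomial, if_pos rfl]
  exact le_self_add

/-- Iterating a block of pair counts `N` gives trees with pair counts `N' + L • N` of every size. -/
lemma exists_le_coeff_treePoly (he : 0 < e)
    (hq : ∀ a b, Relation.TransGen (fun a b => 0 < q a b) a b) (r : 𝒳) (N : 𝒳 × 𝒳 →₀ ℕ) (D : ℕ) :
    ∃ δ > 0, ∃ B, ∀ j < D, ∃ N', edgeSum (1 : 𝒳 × 𝒳 → ℕ) N' = B + j ∧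
      ∀ L : ℕ, ∃ h, δ * blockWeight e q N ^ L ≤ coeff (N' + L • N) (treePoly e q h r) := by
  obtain ⟨c1, hc1, N1, H1⟩ := CanProduce.grow he hq r fun b => ∑ a, N (a, b)
  obtain ⟨c2, hc2, H2⟩ := exists_produces_zero e q he fun b => ∑ a, N (a, b)
  obtain ⟨b, hb⟩ : ∃ b, 0 < q r b := by
    obtain ⟨b, hb, -⟩ := Relation.TransGen.head'_iff.1 (hq r r)
    exact ⟨b, hb⟩
  choose c3 hc3 N3 hN3 H3 using fun j => exists_produces_zero_of_edgeSum he hb j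
  obtain ⟨δ, hδ, hδj⟩ : ∃ δ > 0, ∀ j < D, δ ≤ c3 j := by
    induction D with
    | zero => exact ⟨1, one_pos, by simp⟩
    | succ D ih =>
      obtain ⟨δ, hδ, h⟩ := ih
      refine ⟨min δ (c3 D), lt_min hδ (hc3 D), fun j hj => ?_⟩
      rcases Nat.lt_succ_iff_lt_or_eq.1 hj with hj | rfl
      · exact (min_le_left _ _).trans (h j hj)
      · exact min_le_right _ _
  refine ⟨c1 * c2 * δ, mul_pos (mul_pos hc1 hc2) hδ, edgeSum 1 N1, fun j hj =>
    ⟨N1 + N3 j, by rw [map_add, hN3], fun L => ?_⟩⟩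
  have H := (H1.trans (((produces_block e q N).iterate L).add (Produces.refl _))).trans
    (H2.add (H3 j))
  rw [add_zero] at H
  obtain ⟨h, hh⟩ := H.exists_le_coeff
  refine ⟨h, ?_⟩
  have hN : N1 + L • N + (0 + N3 j) = N1 + N3 j + L • N := by abel
  rw [hN] at hh
  refine le_trans ?_ hh
  calc c1 * c2 * δ * blockWeight e q N ^ L ≤ c1 * c2 * c3 j * blockWeight e q N ^ L := by
        gcongr
        exact hδj j hj
    _ = _ := by ring

end Production

section LowerBound

open MvPolynomial

lemma transGen_of_pow_pos {Q : 𝒳 → 𝒳 → ℝ} (hQ : ∀ a b, 0 ≤ Q a b) {m : ℕ} {a b : 𝒳}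
    (h : 0 < ((Matrix.of Q) ^ (m + 1)) a b) : Relation.TransGen (fun a b => 0 < Q a b) a b := by
  have hnn : ∀ (m : ℕ) (a b : 𝒳), 0 ≤ ((Matrix.of Q) ^ m) a b := by
    intro m
    induction m with
    | zero =>
      intro a b
      rw [pow_zero, Matrix.one_apply]
      split_ifs <;> norm_num
    | succ m ih =>
      intro a b
      rw [pow_succ, Matrix.mul_apply]
      exact Finset.sum_nonneg fun c _ => mul_nonneg (ih a c) (hQ c b)
  induction m generalizing b with
  | zero => exact .single (by simpa using h)
  | succ m ih =>
    rw [pow_succ, Matrix.mul_apply] at h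
    obtain ⟨c, hc⟩ : ∃ c, 0 < ((Matrix.of Q) ^ (m + 1)) a c * Q c b := by
      by_contra! hc
      exact absurd h (not_lt.2 (Finset.sum_nonpos fun c _ => hc c))
    exact (ih (pos_of_mul_pos_left hc (hQ c b))).tail (pos_of_mul_pos_right hc (hnn _ a c))

lemma PTree.map_treeProd {𝒴 R S : Type*} [CommSemiring R] [CommSemiring S] (f : R →+* S)
    (P : 𝒴 → ℕ → R) (q : 𝒴 → 𝒴 → R) (t : PTree 𝒴) :
    f (t.treeProd P q) = t.treeProd (fun a m => f (P a m)) (fun a b => f (q a b)) := by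
  simp only [treeProd, map_list_prod, List.map_map, Function.comp_def, map_mul]

/-- The number `e⁻¹`. -/
noncomputable def expNegOne : ℝ≥0 := (Real.exp (-1)).toNNReal

lemma expNegOne_pos : 0 < expNegOne := Real.toNNReal_pos.2 (Real.exp_pos _)

lemma coe_expNegOne : (expNegOne : ℝ) = Real.exp (-1) := Real.coe_toNNReal _ (Real.exp_pos _).le

lemma coeff_treePoly_eq {Q : 𝒳 → 𝒳 → ℝ} (hQ : ∀ a b, 0 ≤ Q a b) (h : ℕ) (r : 𝒳)
    (N : 𝒳 × 𝒳 →₀ ℕ) :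
    ((coeff N (treePoly expNegOne (fun a b => (Q a b).toNNReal) h r) : ℝ≥0) : ℝ) =
      ∑ t ∈ boundedTrees h r with pairExp t = N, t.treeProd (fun _ => poissonLaw) Q := by
  rw [treePoly, coeff_sum, NNReal.coe_sum, Finset.sum_filter]
  refine Finset.sum_congr rfl fun t _ => ?_
  rw [PTree.treeProd_eq_monomial, coeff_monomial]
  split_ifs with ht
  · refine (PTree.map_treeProd NNReal.toRealHom _ _ t).trans ?_
    congr 1
    · ext _ m
      simp [poissonLaw, coe_expNegOne]
    · ext a b
      exact Real.coe_toNNReal _ (hQ a b)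
  · rfl

lemma le_eventMass_of_coeff {μ0 : 𝒳 → ℝ} {Q : 𝒳 → 𝒳 → ℝ} (hQ : ∀ a b, 0 ≤ Q a b) (h : ℕ)
    {r : 𝒳} (hr : 0 ≤ μ0 r) {N : 𝒳 × 𝒳 →₀ ℕ} {n : ℕ} {E : Set (PTree 𝒳)}
    (hE : ∀ t : PTree 𝒳, pairExp t = N → t.size = n ∧ t ∈ E) :
    ENNReal.ofReal
        (μ0 r * (coeff N (treePoly expNegOne (fun a b => (Q a b).toNNReal) h r) : ℝ≥0)) ≤
      eventMass (jointWeight poissonLaw μ0 Q) n E := by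
  classical
  rw [coeff_treePoly_eq hQ, Finset.mul_sum, ENNReal.ofReal_sum_of_nonneg, eventMass]
  · refine le_trans (Finset.sum_le_sum fun t ht => ?_) (ENNReal.sum_le_tsum _)
    obtain ⟨ht, htN⟩ := Finset.mem_filter.1 ht
    rw [if_pos (hE t htN), jointWeight_eq, root_of_mem_boundedTrees ht]
  · intro t _
    exact mul_nonneg hr (PTree.treeProd_nonneg
      (fun _ m => div_nonneg (Real.exp_pos _).le (Nat.cast_nonneg _)) hQ t)

/-- The normalisation of a vector of pair counts. -/
noncomputable def pairFreq (N : 𝒳 × 𝒳 →₀ ℕ) (x : 𝒳 × 𝒳) : ℝ :=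
  (N x : ℝ) / (edgeSum (1 : 𝒳 × 𝒳 → ℕ) N : ℕ)

lemma empPair_eq_pairFreq (t : PTree 𝒳) : empPair t = pairFreq (pairExp t) := by
  ext x
  rw [empPair, pairFreq, pairExp_apply, PTree.size_eq_edgeSum]
  simp

lemma le_edgeSum_one (N : 𝒳 × 𝒳 →₀ ℕ) (x : 𝒳 × 𝒳) : N x ≤ edgeSum (1 : 𝒳 × 𝒳 → ℕ) N := by
  rw [edgeSum_apply]
  simpa using Finset.single_le_sum (f := fun x => N x) (fun _ _ => Nat.zero_le _)
    (Finset.mem_univ x)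

lemma abs_pairFreq_sub_le (N N' : 𝒳 × 𝒳 →₀ ℕ) (L : ℕ)
    (hN : 0 < edgeSum (1 : 𝒳 × 𝒳 → ℕ) N) (hM : 0 < edgeSum (1 : 𝒳 × 𝒳 → ℕ) (N' + L • N))
    (x : 𝒳 × 𝒳) :
    |pairFreq (N' + L • N) x - pairFreq N x| ≤
      2 * (edgeSum (1 : 𝒳 × 𝒳 → ℕ) N' : ℕ) / (edgeSum (1 : 𝒳 × 𝒳 → ℕ) (N' + L • N) : ℕ) := by
  have h1 := le_edgeSum_one N x
  have h2 := le_edgeSum_one N' x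
  have h3 : edgeSum (1 : 𝒳 × 𝒳 → ℕ) (N' + L • N) =
      edgeSum (1 : 𝒳 × 𝒳 → ℕ) N' + L * edgeSum (1 : 𝒳 × 𝒳 → ℕ) N := by
    rw [map_add, map_nsmul, smul_eq_mul]
  rw [pairFreq, pairFreq]
  simp only [Finsupp.add_apply, Finsupp.smul_apply, smul_eq_mul]
  set M := edgeSum (1 : 𝒳 × 𝒳 → ℕ) (N' + L • N)
  set D := edgeSum (1 : 𝒳 × 𝒳 → ℕ) N
  set B := edgeSum (1 : 𝒳 × 𝒳 → ℕ) N'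
  have hM' : (0 : ℝ) < M := by exact_mod_cast hM
  have hD' : (0 : ℝ) < D := by exact_mod_cast hN
  have h1' : (N x : ℝ) ≤ D := by exact_mod_cast h1
  have h2' : (N' x : ℝ) ≤ B := by exact_mod_cast h2
  have h3' : (M : ℝ) = B + L * D := by exact_mod_cast h3
  have hx : (0 : ℝ) ≤ N x := Nat.cast_nonneg _
  have hx' : (0 : ℝ) ≤ N' x := Nat.cast_nonneg _
  have hB : (0 : ℝ) ≤ B := Nat.cast_nonneg _
  push_cast
  have h4 : ((N' x : ℝ) + L * N x) / M - N x / D = (N' x - B * (N x / D)) / M := by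
    field_simp
    rw [h3']
    ring
  rw [h4, abs_div, abs_of_pos hM']
  refine div_le_div_of_nonneg_right ?_ hM'.le
  have h5 : (N x : ℝ) / D ≤ 1 := (div_le_one hD').2 h1'
  have h6 : 0 ≤ (N x : ℝ) / D := div_nonneg hx hD'.le
  rw [abs_le]
  constructor <;> nlinarith

/-- Trees built from many copies of a block of pair counts `N`. -/
lemma exists_exp_le_eventMass_of_block {μ0 : 𝒳 → ℝ}
    (hμ0_sum : ∑ a, μ0 a = 1) {Q : 𝒳 → 𝒳 → ℝ} (hQ : ∀ a b, 0 ≤ Q a b)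
    (hQ_irr : ∀ a b, ∃ m : ℕ, 0 < ((Matrix.of Q) ^ (m + 1)) a b)
    {O : Set (PV 𝒳)} (hO : IsOpen O) {N : 𝒳 × 𝒳 →₀ ℕ} (hN : 0 < edgeSum (1 : 𝒳 × 𝒳 → ℕ) N)
    (hprob : IsProbVec (pairFreq N)) (hNO : (⟨pairFreq N, hprob⟩ : PV 𝒳) ∈ O)
    (hA : 0 < blockWeight expNegOne (fun a b => (Q a b).toNNReal) N) :
    ∃ C > 0, ∀ᶠ n : ℕ in atTop, ENNReal.ofReal (C * Real.exp (n *
        (Real.log (blockWeight expNegOne (fun a b => (Q a b).toNNReal) N) /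
          (edgeSum (1 : 𝒳 × 𝒳 → ℕ) N : ℕ)))) ≤
      eventMass (jointWeight poissonLaw μ0 Q) n (pairEvent O) := by
  set q : 𝒳 → 𝒳 → ℝ≥0 := fun a b => (Q a b).toNNReal with hq
  set A : ℝ≥0 := blockWeight expNegOne q N with hAdef
  set D := edgeSum (1 : 𝒳 × 𝒳 → ℕ) N with hD
  obtain ⟨r, hr⟩ : ∃ r, 0 < μ0 r := by
    by_contra! h
    have : ∑ a, μ0 a ≤ 0 := Finset.sum_nonpos fun a _ => h a
    linarith
  have hpath : ∀ a b, Relation.TransGen (fun a b => 0 < q a b) a b := by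
    intro a b
    obtain ⟨m, hm⟩ := hQ_irr a b
    refine Relation.TransGen.mono (fun a b hab => ?_) a b (transGen_of_pow_pos hQ hm)
    exact Real.toNNReal_pos.2 hab
  obtain ⟨δ, hδ, B, H⟩ := exists_le_coeff_treePoly expNegOne_pos hpath r N D
  choose! N' hN' H using H
  obtain ⟨ε, hε, hball⟩ := Metric.isOpen_iff.1 hO _ hNO
  have hA' : (0 : ℝ) < A := by exact_mod_cast hA
  have hD' : (0 : ℝ) < D := by exact_mod_cast hN
  refine ⟨μ0 r * δ * Real.exp (-(|Real.log A| * (1 + B + D) / D)), by positivity, ?_⟩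
  have hlim : Tendsto (fun n : ℕ => ((n : ℝ) - 1) * ε) atTop atTop :=
    (tendsto_atTop_add_const_right _ _ tendsto_natCast_atTop_atTop).atTop_mul_const hε
  filter_upwards [eventually_ge_atTop (B + 2), hlim.eventually_gt_atTop (2 * ((B : ℝ) + D))]
    with n hn hn'
  obtain ⟨L, j, hj, hnL⟩ : ∃ L j, j < D ∧ n = B + j + L * D + 1 := by
    refine ⟨(n - 1 - B) / D, (n - 1 - B) % D, Nat.mod_lt _ hN, ?_⟩
    have := Nat.mod_add_div' (n - 1 - B) D
    omega
  obtain ⟨h, hh⟩ := H j hj L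
  have hsum : edgeSum (1 : 𝒳 × 𝒳 → ℕ) (N' j + L • N) = B + j + L * D := by
    rw [map_add, map_nsmul, smul_eq_mul, hN' j hj]
  refine le_trans (ENNReal.ofReal_le_ofReal ?_)
    (le_eventMass_of_coeff hQ h hr.le (N := N' j + L • N) ?_)
  · have hh' : (δ : ℝ) * (A : ℝ) ^ L ≤
        (coeff (N' j + L • N) (treePoly expNegOne q h r) : ℝ≥0) := by
      exact_mod_cast hh
    refine le_trans ?_ (mul_le_mul_of_nonneg_left hh' hr.le)
    rw [mul_assoc, mul_assoc, ← Real.exp_add]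
    refine mul_le_mul_of_nonneg_left (mul_le_mul_of_nonneg_left ?_ δ.2) hr.le
    rw [← Real.exp_log (pow_pos hA' L), Real.log_pow]
    refine Real.exp_le_exp.2 ?_
    have hnL' : (n : ℝ) = B + j + L * D + 1 := by exact_mod_cast hnL
    have hj' : (j : ℝ) ≤ D := by exact_mod_cast hj.le
    have h1 : (n : ℝ) * (Real.log A / D) = L * Real.log A + (B + j + 1) * (Real.log A / D) := by
      rw [hnL']
      field_simp
      ring
    have h2 : (B + j + 1) * (Real.log A / D) ≤ |Real.log A| * (1 + B + D) / D := by
      rw [← mul_div_assoc]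
      refine div_le_div_of_nonneg_right ?_ hD'.le
      calc (B + j + 1) * Real.log A ≤ (B + j + 1) * |Real.log A| :=
            mul_le_mul_of_nonneg_left (le_abs_self _) (by positivity)
        _ ≤ (1 + B + D) * |Real.log A| :=
            mul_le_mul_of_nonneg_right (by linarith) (abs_nonneg _)
        _ = _ := mul_comm _ _
    linarith
  · intro t ht
    have hsize : t.size = n := by
      rw [PTree.size_eq_edgeSum, ht, hsum, hnL]
    refine ⟨hsize, isProbVec_empPair (by omega), hball ?_⟩
    rw [Metric.mem_ball, Subtype.dist_eq, dist_pi_lt_iff hε]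
    intro x
    have hM : 0 < edgeSum (1 : 𝒳 × 𝒳 → ℕ) (N' j + L • N) := by omega
    have := abs_pairFreq_sub_le N (N' j) L hN hM x
    change |empPair t x - pairFreq N x| < ε
    rw [empPair_eq_pairFreq, ht]
    refine this.trans_lt ?_
    rw [div_lt_iff₀ (by exact_mod_cast hM), hsum, hN' j hj]
    have hj' : (j : ℝ) < D := by exact_mod_cast hj
    have hnL' : (n : ℝ) = B + j + L * D + 1 := by exact_mod_cast hnL
    push_cast
    have : (n : ℝ) - 1 = B + j + L * D := by linarith
    rw [this] at hn'
    linarith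

end LowerBound

section Approximation

lemma Real.log_factorial_le (n : ℕ) :
    Real.log (Nat.factorial n) ≤ n * Real.log n - n + 2 * Real.log (n + 1) + 1 := by
  induction n with
  | zero => simp
  | succ n ih =>
    have hn : (0 : ℝ) ≤ n := Nat.cast_nonneg n
    have h1 : (0 : ℝ) < (n : ℝ) + 1 := by linarith
    have h2 : (0 : ℝ) < (n : ℝ) + 1 + 1 := by linarith
    have h3 : (n : ℝ) / (n + 1) ≤ n * Real.log (n + 1) - n * Real.log n := by
      rcases hn.eq_or_lt with h | h
      · simp [← h]
      · have := Real.one_sub_inv_le_log_of_pos (div_pos h1 h)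
        rw [Real.log_div h1.ne' h.ne', inv_div] at this
        have h4 := mul_le_mul_of_nonneg_left this hn
        have h5 : (n : ℝ) * (1 - n / (n + 1)) = n / (n + 1) := by
          field_simp
          ring
        linarith
    have h4 : 1 / ((n : ℝ) + 1 + 1) ≤ Real.log (n + 1 + 1) - Real.log (n + 1) := by
      have := Real.one_sub_inv_le_log_of_pos (div_pos h2 h1)
      rw [Real.log_div h2.ne' h1.ne', inv_div] at this
      have h5 : 1 - ((n : ℝ) + 1) / (n + 1 + 1) = 1 / (n + 1 + 1) := by
        field_simp
        ring
      linarith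
    have h5 : 1 ≤ (n : ℝ) / (n + 1) + 2 * (1 / ((n : ℝ) + 1 + 1)) := by
      rw [mul_one_div, div_add_div _ _ h1.ne' h2.ne', le_div_iff₀ (mul_pos h1 h2)]
      nlinarith
    rw [Nat.factorial_succ, Nat.cast_mul, Nat.cast_succ, Real.log_mul h1.ne'
      (by exact_mod_cast Nat.factorial_ne_zero n)]
    linarith

lemma log_blockWeight {q : 𝒳 → 𝒳 → ℝ≥0} {N : 𝒳 × 𝒳 →₀ ℕ}
    (hN : ∀ x : 𝒳 × 𝒳, N x ≠ 0 → 0 < ∑ c, N (c, x.1) ∧ 0 < q x.1 x.2) :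
    0 < blockWeight expNegOne q N ∧
      Real.log (blockWeight expNegOne q N) = -(edgeSum (1 : 𝒳 × 𝒳 → ℕ) N : ℕ) +
        ∑ x : 𝒳 × 𝒳, ((N x : ℝ) * Real.log ((∑ c, N (c, x.1) : ℕ) * q x.1 x.2) -
          Real.log (Nat.factorial (N x))) := by
  have hpos : ∀ a b, 0 < ((((∑ c, N (c, a) : ℕ) : ℝ≥0) * q a b) ^ N (a, b) /
      (Nat.factorial (N (a, b)))) := by
    intro a b
    refine div_pos ?_ (by exact_mod_cast Nat.factorial_pos _)
    by_cases h : N (a, b) = 0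
    · simp [h]
    · obtain ⟨h1, h2⟩ := hN (a, b) h
      exact pow_pos (mul_pos (by exact_mod_cast h1) h2) _
  have hpos' : ∀ a, 0 < expNegOne ^ (∑ c, N (c, a)) *
      ∏ b, ((((∑ c, N (c, a) : ℕ) : ℝ≥0) * q a b) ^ N (a, b) / (Nat.factorial (N (a, b)))) :=
    fun a => mul_pos (pow_pos expNegOne_pos _) (Finset.prod_pos fun b _ => hpos a b)
  refine ⟨Finset.prod_pos fun a _ => hpos' a, ?_⟩
  rw [blockWeight, NNReal.coe_prod, Real.log_prod
    (fun a _ => by exact_mod_cast (hpos' a).ne')]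
  have hD : ((edgeSum (1 : 𝒳 × 𝒳 → ℕ) N : ℕ) : ℝ) = ∑ a, ((∑ c, N (c, a) : ℕ) : ℝ) := by
    rw [edgeSum_apply, ← Nat.cast_sum]
    congr 1
    rw [Fintype.sum_prod_type_right]
    simp
  rw [hD, Fintype.sum_prod_type, ← Finset.sum_neg_distrib, ← Finset.sum_add_distrib]
  refine Finset.sum_congr rfl fun a _ => ?_
  rw [NNReal.coe_mul, NNReal.coe_pow, NNReal.coe_prod, Real.log_mul, Real.log_pow, coe_expNegOne,
    Real.log_exp, Real.log_prod]
  · congr 1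
    · ring
    · refine Finset.sum_congr rfl fun b _ => ?_
      rw [NNReal.coe_div, NNReal.coe_pow, NNReal.coe_mul, NNReal.coe_natCast, NNReal.coe_natCast,
        Real.log_div, Real.log_pow]
      · have := (hpos a b).ne'
        rw [Ne, div_eq_zero_iff, not_or] at this
        exact_mod_cast this.1
      · exact_mod_cast Nat.factorial_ne_zero _
  · intro b _
    exact_mod_cast (hpos a b).ne'
  · exact_mod_cast (pow_pos expNegOne_pos _).ne'
  · rw [← NNReal.coe_prod]
    exact_mod_cast (Finset.prod_pos fun b _ => hpos a b).ne'

/-- The integer approximation of the vector `s μ`. -/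
noncomputable def floorCount (μ : 𝒳 × 𝒳 → ℝ) (s : ℕ) : 𝒳 × 𝒳 →₀ ℕ :=
  Finsupp.equivFunOnFinite.symm fun x => ⌊μ x * s⌋₊

lemma floorCount_apply (μ : 𝒳 × 𝒳 → ℝ) (s : ℕ) (x : 𝒳 × 𝒳) :
    floorCount μ s x = ⌊μ x * s⌋₊ := rfl

lemma tendsto_floorCount_div {μ : 𝒳 × 𝒳 → ℝ} (hμ : ∀ x, 0 ≤ μ x) (x : 𝒳 × 𝒳) :
    Tendsto (fun s : ℕ => (floorCount μ s x : ℝ) / s) atTop (nhds (μ x)) :=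
  (tendsto_nat_floor_mul_div_atTop (hμ x)).comp tendsto_natCast_atTop_atTop

lemma tendsto_edgeSum_floorCount_div {μ : 𝒳 × 𝒳 → ℝ} (hμ : IsProbVec μ) :
    Tendsto (fun s : ℕ => ((edgeSum (1 : 𝒳 × 𝒳 → ℕ) (floorCount μ s) : ℕ) : ℝ) / s) atTop
      (nhds 1) := by
  rw [← hμ.2]
  refine (tendsto_finsetSum _ fun x _ => tendsto_floorCount_div hμ.1 x).congr fun s => ?_
  rw [edgeSum_apply]
  push_cast
  simp [Finset.sum_div]

lemma tendsto_pairFreq_floorCount {μ : 𝒳 × 𝒳 → ℝ} (hμ : IsProbVec μ) :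
    Tendsto (fun s : ℕ => pairFreq (floorCount μ s)) atTop (nhds μ) := by
  rw [tendsto_pi_nhds]
  intro x
  have h := (tendsto_floorCount_div hμ.1 x).div (tendsto_edgeSum_floorCount_div hμ) one_ne_zero
  rw [div_one] at h
  refine h.congr' ?_
  filter_upwards [eventually_gt_atTop 0] with s hs
  have hs' : (s : ℝ) ≠ 0 := by exact_mod_cast hs.ne'
  exact div_div_div_cancel_right₀ hs' _ _

lemma isProbVec_pairFreq {N : 𝒳 × 𝒳 →₀ ℕ} (hN : 0 < edgeSum (1 : 𝒳 × 𝒳 → ℕ) N) :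
    IsProbVec (pairFreq N) := by
  have h : ((edgeSum (1 : 𝒳 × 𝒳 → ℕ) N : ℕ) : ℝ) ≠ 0 := by exact_mod_cast hN.ne'
  refine ⟨fun x => div_nonneg (Nat.cast_nonneg _) (Nat.cast_nonneg _), ?_⟩
  simp only [pairFreq]
  rw [← Finset.sum_div, div_eq_one_iff_eq h, edgeSum_apply]
  push_cast
  simp

lemma tendsto_log_add_one_div :
    Tendsto (fun s : ℕ => (2 * Real.log (s + 1) + 1) / (s : ℝ)) atTop (nhds 0) := by
  have h1 : Tendsto (fun x : ℝ => Real.log x / x) atTop (nhds 0) := by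
    simpa using Real.tendsto_pow_log_div_mul_add_atTop 1 0 1 one_ne_zero
  have h2 : Tendsto (fun s : ℕ => (s : ℝ) + 1) atTop atTop :=
    tendsto_atTop_add_const_right _ _ tendsto_natCast_atTop_atTop
  have h3 : Tendsto (fun s : ℕ => (s : ℝ)⁻¹) atTop (nhds 0) :=
    tendsto_inv_atTop_zero.comp tendsto_natCast_atTop_atTop
  have h4 := (((h1.comp h2).mul (h3.const_add 1)).const_mul 2).add h3
  simp only [add_zero, zero_mul, mul_zero] at h4
  refine h4.congr' ?_
  filter_upwards [eventually_gt_atTop 0] with s hs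
  have hs' : (0 : ℝ) < s := by exact_mod_cast hs
  simp only [Function.comp_apply]
  field_simp

lemma exists_block_of_ac {Q : 𝒳 → 𝒳 → ℝ} (hQ : ∀ a b, 0 ≤ Q a b) (μ : PV 𝒳)
    (hac : ∀ x, sndKernel Q μ.1 x = 0 → μ.1 x = 0) {O : Set (PV 𝒳)} (hO : IsOpen O) (hμO : μ ∈ O)
    {c : ℝ} (hc : c < -∑ x, μ.1 x * Real.log (μ.1 x / sndKernel Q μ.1 x)) :
    ∃ N : 𝒳 × 𝒳 →₀ ℕ, 0 < edgeSum (1 : 𝒳 × 𝒳 → ℕ) N ∧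
      (∃ h : IsProbVec (pairFreq N), (⟨pairFreq N, h⟩ : PV 𝒳) ∈ O) ∧
      0 < blockWeight expNegOne (fun a b => (Q a b).toNNReal) N ∧
      c ≤ Real.log (blockWeight expNegOne (fun a b => (Q a b).toNNReal) N) /
          (edgeSum (1 : 𝒳 × 𝒳 → ℕ) N : ℕ) := by
  obtain ⟨μ, hμ⟩ := μ
  simp only at hac hc
  set D : ℕ → ℕ := fun s => edgeSum (1 : 𝒳 × 𝒳 → ℕ) (floorCount μ s) with hD
  have hDlim := tendsto_edgeSum_floorCount_div hμ
  have hDpos : ∀ᶠ s in atTop, 0 < D s := by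
    filter_upwards [hDlim.eventually_const_lt one_pos, eventually_gt_atTop 0] with s hs hs0
    have hs0' : (0 : ℝ) < s := by exact_mod_cast hs0
    have := (div_pos_iff_of_pos_right hs0').1 hs
    exact_mod_cast this
  have hsnd : ∀ x, μ x ≠ 0 → 0 < sndKernel Q μ x := fun x hx =>
    lt_of_le_of_ne (sndKernel_nonneg hQ hμ x) fun h => hx (hac x h.symm)
  have hklim : ∀ a, Tendsto (fun s : ℕ => ((∑ c, floorCount μ s (c, a) : ℕ) : ℝ) / s) atTop
      (nhds (∑ c, μ (c, a))) := by
    intro a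
    refine (tendsto_finsetSum _ fun c _ => tendsto_floorCount_div hμ.1 (c, a)).congr fun s => ?_
    push_cast
    rw [Finset.sum_div]
  have hkpos : ∀ᶠ s in atTop, ∀ x, μ x ≠ 0 → 0 < ∑ c, floorCount μ s (c, x.1) := by
    rw [eventually_all]
    intro x
    by_cases hx : μ x = 0
    · exact Eventually.of_forall fun s h => absurd hx h
    · have h1 : 0 < ∑ c, μ (c, x.1) := pos_of_mul_pos_left (hsnd x hx) (hQ _ _)
      filter_upwards [(hklim x.1).eventually_const_lt h1, eventually_gt_atTop 0] with s hs hs0 _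
      have hs0' : (0 : ℝ) < s := by exact_mod_cast hs0
      have := (div_pos_iff_of_pos_right hs0').1 hs
      exact_mod_cast this
  have hQpos : ∀ x, μ x ≠ 0 → 0 < Q x.1 x.2 := fun x hx =>
    pos_of_mul_pos_right (hsnd x hx) (Finset.sum_nonneg fun c _ => hμ.1 (c, x.1))
  have hzero : ∀ x s, μ x = 0 → floorCount μ s x = 0 := by
    intro x s hx
    rw [floorCount_apply, hx, zero_mul, Nat.floor_zero]
  set f : ℕ → 𝒳 × 𝒳 → ℝ := fun s x =>
    (floorCount μ s x : ℝ) / s *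
        Real.log (((∑ c, floorCount μ s (c, x.1) : ℕ) : ℝ) / s * Q x.1 x.2) -
      (floorCount μ s x : ℝ) / s * Real.log ((floorCount μ s x : ℝ) / s) -
      (2 * Real.log (s + 1) + 1) / (s : ℝ) with hf
  have hflim : Tendsto (fun s => ∑ x, f s x) atTop
      (nhds (-∑ x, μ x * Real.log (μ x / sndKernel Q μ x))) := by
    rw [← Finset.sum_neg_distrib]
    refine tendsto_finsetSum _ fun x _ => ?_
    by_cases hx : μ x = 0
    · have : ∀ s, f s x = - ((2 * Real.log (s + 1) + 1) / (s : ℝ)) := by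
        intro s
        simp [hf, hzero x s hx]
      simp only [this, hx, zero_mul]
      exact tendsto_log_add_one_div.neg
    · have h1 := tendsto_floorCount_div hμ.1 x
      have h2 := h1.mul (((hklim x.1).mul_const (Q x.1 x.2)).log (hsnd x hx).ne')
      have h3 := h1.mul (h1.log hx)
      have h4 := (h2.sub h3).sub tendsto_log_add_one_div
      convert h4 using 2
      rw [Real.log_div hx (hsnd x hx).ne', sndKernel]
      ring
  have hfD : Tendsto (fun s : ℕ => (∑ x, f s x) / ((D s : ℝ) / s)) atTop
      (nhds (-∑ x, μ x * Real.log (μ x / sndKernel Q μ x))) := by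
    have h := hflim.div hDlim one_ne_zero
    rwa [div_one] at h
  have hOlim : ∀ᶠ s in atTop, ∃ h : IsProbVec (pairFreq (floorCount μ s)),
      (⟨pairFreq (floorCount μ s), h⟩ : PV 𝒳) ∈ O := by
    obtain ⟨U, hU, rfl⟩ := isOpen_induced_iff.1 hO
    filter_upwards [hDpos, (tendsto_pairFreq_floorCount hμ).eventually (hU.mem_nhds hμO)]
      with s hs hsU
    exact ⟨isProbVec_pairFreq hs, hsU⟩
  obtain ⟨s, hsD, hsk, hsO, hsc, hs0⟩ := (hDpos.and (hkpos.and (hOlim.and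
    ((hfD.eventually_const_lt hc).and (eventually_gt_atTop 0))))).exists
  have hs0' : (0 : ℝ) < s := by exact_mod_cast hs0
  have hsD' : (0 : ℝ) < D s := by exact_mod_cast hsD
  obtain ⟨hA, hlog⟩ := log_blockWeight (q := fun a b => (Q a b).toNNReal) (N := floorCount μ s)
    fun x hx => by
      have hx' : μ x ≠ 0 := fun h => hx (hzero x s h)
      exact ⟨hsk x hx', Real.toNNReal_pos.2 (hQpos x hx')⟩
  refine ⟨floorCount μ s, hsD, hsO, hA, hsc.le.trans ?_⟩
  rw [div_div_eq_mul_div]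
  refine div_le_div_of_nonneg_right ?_ hsD'.le
  have hDsum : ((edgeSum (1 : 𝒳 × 𝒳 → ℕ) (floorCount μ s) : ℕ) : ℝ) =
      ∑ x, (floorCount μ s x : ℝ) := by
    rw [edgeSum_apply]
    push_cast
    simp
  rw [hlog, hDsum, ← Finset.sum_neg_distrib, ← Finset.sum_add_distrib, Finset.sum_mul]
  refine Finset.sum_le_sum fun x _ => ?_
  have hfac := Real.log_factorial_le (floorCount μ s x)
  have hle : (floorCount μ s x : ℝ) ≤ s := by
    rw [floorCount_apply]
    refine (Nat.floor_le (mul_nonneg (hμ.1 x) hs0'.le)).trans ?_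
    have : μ x ≤ 1 := by
      rw [← hμ.2]
      exact Finset.single_le_sum (fun y _ => hμ.1 y) (Finset.mem_univ x)
    exact mul_le_of_le_one_left hs0'.le this
  have hlogle : Real.log ((floorCount μ s x : ℝ) + 1) ≤ Real.log (s + 1) :=
    Real.log_le_log (by positivity) (by linarith)
  simp only [hf]
  rw [Real.coe_toNNReal _ (hQ _ _)]
  by_cases hx : floorCount μ s x = 0
  · rw [hx] at hfac ⊢
    simp
    have : (2 * Real.log (s + 1) + 1) / (s : ℝ) * s = 2 * Real.log (s + 1) + 1 := by
      field_simp
    have h0 : 0 ≤ Real.log ((s : ℝ) + 1) := Real.log_nonneg (by linarith)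
    linarith
  · have hx' : μ x ≠ 0 := fun h => hx (hzero x s h)
    have hk : (0 : ℝ) < (∑ c, floorCount μ s (c, x.1) : ℕ) := by exact_mod_cast hsk x hx'
    have hn : (0 : ℝ) < floorCount μ s x := by exact_mod_cast Nat.pos_of_ne_zero hx
    rw [div_mul_eq_mul_div ((∑ c, floorCount μ s (c, x.1) : ℕ) : ℝ), Real.log_div (mul_pos hk (hQpos x hx')).ne' hs0'.ne',
      Real.log_div hn.ne' hs0'.ne']
    set n : ℝ := (floorCount μ s x : ℝ)
    have h6 : (n / s * (Real.log (((∑ c, floorCount μ s (c, x.1) : ℕ) : ℝ) * Q x.1 x.2) -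
          Real.log s) - n / s * (Real.log n - Real.log s) - (2 * Real.log (s + 1) + 1) / s) * s =
        n * Real.log (((∑ c, floorCount μ s (c, x.1) : ℕ) : ℝ) * Q x.1 x.2) - n * Real.log n -
          (2 * Real.log (s + 1) + 1) := by
      field_simp
      ring
    rw [h6]
    linarith

end Approximation

section Stationary

lemma exists_stationary [Nonempty 𝒳] {Q : 𝒳 → 𝒳 → ℝ} (hQ : ∀ a b, 0 ≤ Q a b)
    (hQ_sum : ∀ a, ∑ b, Q a b = 1) :
    ∃ π : 𝒳 → ℝ, (∀ a, 0 ≤ π a) ∧ ∑ a, π a = 1 ∧ ∀ b, ∑ a, π a * Q a b = π b := by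
  obtain ⟨v, hv0, hv⟩ : ∃ v : 𝒳 → ℝ, v ≠ 0 ∧ Matrix.vecMul v (Matrix.of Q - 1) = 0 := by
    rw [Matrix.exists_vecMul_eq_zero_iff, ← Matrix.exists_mulVec_eq_zero_iff]
    refine ⟨1, one_ne_zero, ?_⟩
    rw [Matrix.sub_mulVec, Matrix.one_mulVec]
    ext a
    simp [Matrix.mulVec, dotProduct, hQ_sum]
  have hvQ : ∀ b, ∑ a, v a * Q a b = v b := by
    intro b
    rw [Matrix.vecMul_sub, Matrix.vecMul_one, sub_eq_zero] at hv
    exact congrFun hv b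
  have hle : ∀ b ∈ Finset.univ, |v b| ≤ ∑ a, |v a| * Q a b := by
    intro b _
    rw [← hvQ b]
    refine (Finset.abs_sum_le_sum_abs _ _).trans (Finset.sum_le_sum fun a _ => ?_)
    rw [abs_mul, abs_of_nonneg (hQ a b)]
  have hsum : ∑ b, |v b| = ∑ b, ∑ a, |v a| * Q a b := by
    rw [Finset.sum_comm]
    simp_rw [← Finset.mul_sum, hQ_sum, mul_one]
  have heq := (Finset.sum_eq_sum_iff_of_le hle).1 hsum
  have hpos : 0 < ∑ b, |v b| := by
    obtain ⟨b, hb⟩ := Function.ne_iff.1 hv0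
    exact Finset.sum_pos' (fun b _ => abs_nonneg _) ⟨b, Finset.mem_univ b, abs_pos.2 hb⟩
  refine ⟨fun a => |v a| / ∑ b, |v b|, fun a => div_nonneg (abs_nonneg _) hpos.le, ?_, fun b => ?_⟩
  · rw [← Finset.sum_div, div_self hpos.ne']
  · simp_rw [div_mul_eq_mul_div]
    rw [← Finset.sum_div, ← heq b (Finset.mem_univ b)]

lemma exists_isProbVec_sndKernel_eq [Nonempty 𝒳] {Q : 𝒳 → 𝒳 → ℝ} (hQ : ∀ a b, 0 ≤ Q a b)
    (hQ_sum : ∀ a, ∑ b, Q a b = 1) : ∃ μ : PV 𝒳, sndKernel Q μ.1 = μ.1 := by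
  obtain ⟨π, hπ, hπ_sum, hπQ⟩ := exists_stationary hQ hQ_sum
  refine ⟨⟨fun x => π x.1 * Q x.1 x.2, fun x => mul_nonneg (hπ _) (hQ _ _), ?_⟩, ?_⟩
  · rw [Fintype.sum_prod_type]
    simp_rw [← Finset.mul_sum, hQ_sum, mul_one, hπ_sum]
  · ext x
    simp only [sndKernel, hπQ]

end Stationary

section ExtendedLog

lemma elog_le_of_le {x : ℝ≥0∞} {z : ℝ} (h : x ≤ ENNReal.ofReal (Real.exp z)) :
    elog x ≤ (z : EReal) := by
  have hx : x ≠ ∞ := (h.trans_lt ENNReal.ofReal_lt_top).ne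
  rw [elog]
  split_ifs with h0
  · exact bot_le
  · have hpos := ENNReal.toReal_pos h0 hx
    rw [EReal.coe_le_coe_iff, Real.log_le_iff_le_exp hpos]
    exact ENNReal.toReal_le_of_le_ofReal (Real.exp_pos z).le h

lemma le_elog_of_le {x : ℝ≥0∞} {z : ℝ} (h : ENNReal.ofReal (Real.exp z) ≤ x) :
    (z : EReal) ≤ elog x := by
  have hx0 : x ≠ 0 := ((ENNReal.ofReal_pos.2 (Real.exp_pos z)).trans_le h).ne'
  rw [elog, if_neg hx0]
  split_ifs with hx
  · exact le_top
  · rw [EReal.coe_le_coe_iff, Real.le_log_iff_exp_le (ENNReal.toReal_pos hx0 hx)]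
    exact (ENNReal.ofReal_le_iff_le_toReal hx).1 h

lemma tendsto_const_div_add (K c : ℝ) :
    Tendsto (fun n : ℕ => (n : ℝ)⁻¹ * (K + n * c)) atTop (nhds c) := by
  have h : Tendsto (fun n : ℕ => (n : ℝ)⁻¹ * K + c) atTop (nhds (0 * K + c)) :=
    ((tendsto_inv_atTop_zero.comp tendsto_natCast_atTop_atTop).mul_const K).add_const c
  rw [zero_mul, zero_add] at h
  refine h.congr' ?_
  filter_upwards [eventually_gt_atTop 0] with n hn
  have hn' : (n : ℝ) ≠ 0 := by exact_mod_cast hn.ne'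
  field_simp

lemma mul_exp_eq_exp {C : ℝ} (hC : 0 < C) (z : ℝ) :
    C * Real.exp z = Real.exp (Real.log C + z) := by
  rw [Real.exp_add, Real.exp_log hC]

lemma eventually_inv_mul_elog_le {x : ℕ → ℝ≥0∞} {C c z : ℝ} (hC : 0 < C) (hcz : c < z)
    (h : ∀ᶠ n : ℕ in atTop, x n ≤ ENNReal.ofReal (C * Real.exp (n * c))) :
    ∀ᶠ n : ℕ in atTop, (((n : ℝ)⁻¹ : ℝ) : EReal) * elog (x n) ≤ (z : EReal) := by
  filter_upwards [h, (tendsto_const_div_add (Real.log C) c).eventually_lt_const hcz] with n hn hz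
  rw [mul_exp_eq_exp hC] at hn
  refine (mul_le_mul_of_nonneg_left (elog_le_of_le hn)
    (EReal.coe_nonneg.2 (inv_nonneg.2 (Nat.cast_nonneg n)))).trans ?_
  rw [← EReal.coe_mul]
  exact EReal.coe_le_coe_iff.2 hz.le

lemma eventually_le_inv_mul_elog {x : ℕ → ℝ≥0∞} {C c z : ℝ} (hC : 0 < C) (hzc : z < c)
    (h : ∀ᶠ n : ℕ in atTop, ENNReal.ofReal (C * Real.exp (n * c)) ≤ x n) :
    ∀ᶠ n : ℕ in atTop, (z : EReal) ≤ (((n : ℝ)⁻¹ : ℝ) : EReal) * elog (x n) := by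
  filter_upwards [h, (tendsto_const_div_add (Real.log C) c).eventually_const_lt hzc] with n hn hz
  rw [mul_exp_eq_exp hC] at hn
  refine le_trans ?_ (mul_le_mul_of_nonneg_left (le_elog_of_le hn)
    (EReal.coe_nonneg.2 (inv_nonneg.2 (Nat.cast_nonneg n))))
  rw [← EReal.coe_mul]
  exact EReal.coe_le_coe_iff.2 hz.le

end ExtendedLog

section LargeDeviations

variable {μ0 : 𝒳 → ℝ} {Q : 𝒳 → 𝒳 → ℝ}

lemma exists_eventMass_ge_of_ac (hμ0_sum : ∑ a, μ0 a = 1)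
    (hQ : ∀ a b, 0 ≤ Q a b) (hQ_irr : ∀ a b, ∃ m : ℕ, 0 < ((Matrix.of Q) ^ (m + 1)) a b)
    (μ : PV 𝒳) (hac : ∀ x, sndKernel Q μ.1 x = 0 → μ.1 x = 0) {O : Set (PV 𝒳)} (hO : IsOpen O)
    (hμO : μ ∈ O) {c : ℝ} (hc : c < -∑ x, μ.1 x * Real.log (μ.1 x / sndKernel Q μ.1 x)) :
    ∃ C > 0, ∀ᶠ n : ℕ in atTop, ENNReal.ofReal (C * Real.exp (n * c)) ≤
      eventMass (jointWeight poissonLaw μ0 Q) n (pairEvent O) := by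
  obtain ⟨N, hN, ⟨hprob, hNO⟩, hA, hcN⟩ := exists_block_of_ac hQ μ hac hO hμO hc
  obtain ⟨C, hC, h⟩ := exists_exp_le_eventMass_of_block hμ0_sum hQ hQ_irr hO hN hprob hNO hA
  refine ⟨C, hC, h.mono fun n hn => (ENNReal.ofReal_le_ofReal ?_).trans hn⟩
  gcongr

lemma exists_treeMass_ge (hμ0_sum : ∑ a, μ0 a = 1)
    (hQ : ∀ a b, 0 ≤ Q a b) (hQ_sum : ∀ a, ∑ b, Q a b = 1)
    (hQ_irr : ∀ a b, ∃ m : ℕ, 0 < ((Matrix.of Q) ^ (m + 1)) a b) {ε : ℝ} (hε : 0 < ε) :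
    ∃ C > 0, ∀ᶠ n : ℕ in atTop, ENNReal.ofReal (C * Real.exp (n * (-ε))) ≤
      treeMass (jointWeight poissonLaw μ0 Q) n := by
  have : Nonempty 𝒳 := by
    by_contra h
    rw [not_nonempty_iff] at h
    simp at hμ0_sum
  obtain ⟨μ, hμ⟩ := exists_isProbVec_sndKernel_eq hQ hQ_sum
  obtain ⟨C, hC, h⟩ := exists_eventMass_ge_of_ac hμ0_sum hQ hQ_irr μ
    (fun x hx => by rwa [hμ] at hx) isOpen_univ (Set.mem_univ μ) (c := -ε) (by
      rw [hμ, neg_lt_neg_iff]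
      refine lt_of_le_of_lt (Finset.sum_nonpos fun x _ => ?_) hε
      by_cases hx : μ.1 x = 0
      · simp [hx]
      · simp [div_self hx])
  refine ⟨C, hC, h.mono fun n hn => hn.trans ?_⟩
  rw [← eventMass_univ]
  exact eventMass_mono _ _ (Set.subset_univ _)

lemma exists_treeMass_le (hμ0 : ∀ a, 0 ≤ μ0 a) (hμ0_sum : ∑ a, μ0 a = 1)
    (hQ : ∀ a b, 0 ≤ Q a b) (hQ_sum : ∀ a, ∑ b, Q a b = 1) :
    ∃ C : ℝ, 0 < C ∧ ∀ n : ℕ, 2 ≤ n →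
      treeMass (jointWeight poissonLaw μ0 Q) n ≤ ENNReal.ofReal C := by
  obtain ⟨C, hC, h⟩ := eventMass_tilt_le hμ0 hμ0_sum hQ 0
  refine ⟨C, hC, fun n hn => ?_⟩
  have h0 := h 0 n hn
  rw [mul_zero, neg_zero, Real.exp_zero, mul_one] at h0
  refine le_trans (ENNReal.tsum_le_tsum fun t => ?_) h0
  split_ifs with h1 h2 h2
  · exact le_rfl
  · refine absurd ⟨h1, isProbVec_empPair (by omega), ?_⟩ h2
    change (0 : ℝ) ≤ tiltRate Q 0 (empPair t)
    rw [tiltRate_eq]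
    simp [sum_sndKernel hQ_sum (isProbVec_empPair (t := t) (by omega))]
  · exact absurd h2.1 h1
  · exact le_rfl

lemma pairEvent_mono {F G : Set (PV 𝒳)} (h : F ⊆ G) : pairEvent F ⊆ pairEvent G :=
  fun _ ⟨hp, hF⟩ => ⟨hp, h hF⟩

lemma eventMass_pairEvent_union_le (w : PTree 𝒳 → ℝ) (n : ℕ) (F G : Set (PV 𝒳)) :
    eventMass w n (pairEvent (F ∪ G)) ≤
      eventMass w n (pairEvent F) + eventMass w n (pairEvent G) := by
  classical
  rw [eventMass, eventMass, eventMass, ← ENNReal.tsum_add]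
  refine ENNReal.tsum_le_tsum fun t => ?_
  by_cases h : t.size = n ∧ t ∈ pairEvent (F ∪ G)
  · obtain ⟨hn, hp, hF | hG⟩ := h
    · rw [if_pos (⟨hn, hp, hF⟩ : t.size = n ∧ t ∈ pairEvent F)]
      split_ifs <;> simp
    · rw [if_pos (⟨hn, hp, hG⟩ : t.size = n ∧ t ∈ pairEvent G)]
      split_ifs <;> simp
  · rw [if_neg h]
    exact zero_le

lemma exists_eventMass_le_of_lt_ratePoisson (hμ0 : ∀ a, 0 ≤ μ0 a) (hμ0_sum : ∑ a, μ0 a = 1)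
    (hQ : ∀ a b, 0 ≤ Q a b) (hQ_sum : ∀ a, ∑ b, Q a b = 1) {F : Set (PV 𝒳)} (hF : IsClosed F)
    {c : ℝ} (hc : ∀ μ ∈ F, (c : EReal) < ratePoisson Q μ.1) :
    ∃ C : ℝ, 0 < C ∧ ∀ n : ℕ, 2 ≤ n →
      eventMass (jointWeight poissonLaw μ0 Q) n (pairEvent F) ≤
        ENNReal.ofReal (C * Real.exp (-(((n : ℝ) - 1) * c))) := by
  refine hF.isCompact.induction_on (p := fun F => ∃ C : ℝ, 0 < C ∧ ∀ n : ℕ, 2 ≤ n →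
      eventMass (jointWeight poissonLaw μ0 Q) n (pairEvent F) ≤
        ENNReal.ofReal (C * Real.exp (-(((n : ℝ) - 1) * c)))) ?_ ?_ ?_ ?_
  · exact ⟨1, one_pos, fun n _ => by simp [eventMass, pairEvent]⟩
  · rintro s t hst ⟨C, hC, h⟩
    exact ⟨C, hC, fun n hn => (eventMass_mono _ n (pairEvent_mono hst)).trans (h n hn)⟩
  · rintro s t ⟨C, hC, h⟩ ⟨C', hC', h'⟩
    refine ⟨C + C', add_pos hC hC', fun n hn => (eventMass_pairEvent_union_le _ n s t).trans ?_⟩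
    rw [add_mul, ENNReal.ofReal_add (by positivity) (by positivity)]
    exact add_le_add (h n hn) (h' n hn)
  · intro μ hμ
    have h := hc μ hμ
    rw [ratePoisson_eq_iSup hQ hQ_sum μ.2, lt_iSup_iff] at h
    obtain ⟨θ, hθ⟩ := h
    have hopen : IsOpen {ν : PV 𝒳 | c < tiltRate Q θ ν.1} :=
      isOpen_lt continuous_const ((continuous_tiltRate Q θ).comp continuous_subtype_val)
    obtain ⟨C, hC, h⟩ := eventMass_tilt_le hμ0 hμ0_sum hQ θ
    refine ⟨_, mem_nhdsWithin_of_mem_nhds (hopen.mem_nhds (EReal.coe_lt_coe_iff.1 hθ)), C, hC,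
      fun n hn => (eventMass_mono _ n (pairEvent_mono ?_)).trans (h c n hn)⟩
    intro ν hν
    have hν' : c < tiltRate Q θ ν.1 := hν
    exact hν'.le

lemma eventually_inv_mul_elog_condP_le (hμ0 : ∀ a, 0 ≤ μ0 a) (hμ0_sum : ∑ a, μ0 a = 1)
    (hQ : ∀ a b, 0 ≤ Q a b) (hQ_sum : ∀ a, ∑ b, Q a b = 1)
    (hQ_irr : ∀ a b, ∃ m : ℕ, 0 < ((Matrix.of Q) ^ (m + 1)) a b) {F : Set (PV 𝒳)}
    (hF : IsClosed F) {z : ℝ} (hz : -⨅ μ ∈ F, ratePoisson Q μ.1 < (z : EReal)) :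
    ∀ᶠ n : ℕ in atTop, (((n : ℝ)⁻¹ : ℝ) : EReal) *
      elog (condP (jointWeight poissonLaw μ0 Q) n (pairEvent F)) ≤ (z : EReal) := by
  obtain ⟨c, hzc, hc⟩ := EReal.lt_iff_exists_real_btwn.1 (EReal.neg_lt_comm.1 hz)
  rw [← EReal.coe_neg, EReal.coe_lt_coe_iff] at hzc
  obtain ⟨C, hC, h⟩ := exists_eventMass_le_of_lt_ratePoisson hμ0 hμ0_sum hQ hQ_sum hF
    (fun μ hμ => hc.trans_le (iInf₂_le μ hμ))
  have hε : 0 < (c + z) / 2 := by linarith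
  obtain ⟨C', hC', h'⟩ := exists_treeMass_ge hμ0_sum hQ hQ_sum hQ_irr hε
  refine eventually_inv_mul_elog_le (C := C * Real.exp c / C') (c := -c + (c + z) / 2)
    (by positivity) (by linarith) ?_
  filter_upwards [h', eventually_ge_atTop 2] with n hn' hn
  rw [condP_eq_eventMass_div]
  refine (ENNReal.div_le_div (h n hn) hn').trans_eq ?_
  rw [← ENNReal.ofReal_div_of_pos (by positivity)]
  congr 1
  have h1 : -(((n : ℝ) - 1) * c) = c + n * (-c) := by ring
  have h2 : (n : ℝ) * (-c + (c + z) / 2) = n * (-c) - n * (-((c + z) / 2)) := by ring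
  rw [h1, h2, Real.exp_add, Real.exp_sub]
  field_simp

lemma eventually_le_inv_mul_elog_condP (hμ0 : ∀ a, 0 ≤ μ0 a) (hμ0_sum : ∑ a, μ0 a = 1)
    (hQ : ∀ a b, 0 ≤ Q a b) (hQ_sum : ∀ a, ∑ b, Q a b = 1)
    (hQ_irr : ∀ a b, ∃ m : ℕ, 0 < ((Matrix.of Q) ^ (m + 1)) a b) {O : Set (PV 𝒳)}
    (hO : IsOpen O) {z : ℝ} (hz : (z : EReal) < -⨅ μ ∈ O, ratePoisson Q μ.1) :
    ∀ᶠ n : ℕ in atTop, (z : EReal) ≤ (((n : ℝ)⁻¹ : ℝ) : EReal) *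
      elog (condP (jointWeight poissonLaw μ0 Q) n (pairEvent O)) := by
  have hz' := EReal.lt_neg_comm.1 hz
  simp only [iInf_lt_iff] at hz'
  obtain ⟨μ, hμO, hμ⟩ := hz'
  have hac : ∀ x, sndKernel Q μ.1 x = 0 → μ.1 x = 0 := by
    by_contra hac
    rw [ratePoisson_of_not_ac hQ hQ_sum μ.2 hac] at hμ
    exact not_top_lt hμ
  rw [ratePoisson_of_ac hQ hQ_sum μ.2 hac, ← EReal.coe_neg, EReal.coe_lt_coe_iff] at hμ
  obtain ⟨c, hzc, hc⟩ := exists_between (lt_neg_of_lt_neg hμ)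
  obtain ⟨C, hC, h⟩ := exists_eventMass_ge_of_ac hμ0_sum hQ hQ_irr μ hac hO hμO hc
  obtain ⟨C', hC', h'⟩ := exists_treeMass_le hμ0 hμ0_sum hQ hQ_sum
  refine eventually_le_inv_mul_elog (C := C / C') (c := c) (by positivity) hzc ?_
  filter_upwards [h, eventually_ge_atTop 2] with n hn hn2
  rw [condP_eq_eventMass_div]
  refine le_trans (le_of_eq ?_) (ENNReal.div_le_div hn (h' n hn2))
  rw [← ENNReal.ofReal_div_of_pos hC']
  congr 1
  ring

end LargeDeviations

theorem poisson_cramer_rate_and_ldp_empirical_pair_measure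
    (μ0 : 𝒳 → ℝ) (hμ0_nonneg : ∀ a, 0 ≤ μ0 a) (hμ0_sum : ∑ a, μ0 a = 1)
    (Q : 𝒳 → 𝒳 → ℝ) (hQ_nonneg : ∀ a b, 0 ≤ Q a b) (hQ_sum : ∀ a, ∑ b, Q a b = 1)
    (hQ_irr : ∀ a b, ∃ m : ℕ, 0 < ((Matrix.of Q) ^ (m + 1)) a b)
    (I : PV 𝒳 → EReal) (hI : ∀ μ, I μ = ratePoisson Q μ.1)
    (S : Set ℕ) (hS : S = sizeSupport (jointWeight poissonLaw μ0 Q)) :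
    -- the explicit form of the Cramér rate function of the Poisson(1) law
    (∀ x : ℝ, 0 ≤ x →
      cramerRate poissonLaw x = ((1 - x + x * Real.log x : ℝ) : EReal)) ∧
    -- `I` is a good rate function
    LowerSemicontinuous I ∧
    (∀ c : ℝ, IsCompact {μ : PV 𝒳 | I μ ≤ (c : EReal)}) ∧
    -- large deviation upper bound, conditionally on `{|T| = n}`, along `n ∈ S`
    (∀ F : Set (PV 𝒳), IsClosed F →
      Filter.limsup
        (fun n : ℕ => (((n : ℝ)⁻¹ : ℝ) : EReal) *
          elog (condP (jointWeight poissonLaw μ0 Q) n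
            {t | ∃ h : IsProbVec (empPair t), (⟨empPair t, h⟩ : PV 𝒳) ∈ F}))
        (Filter.atTop ⊓ Filter.principal S)
        ≤ - ⨅ μ ∈ F, I μ) ∧
    -- large deviation lower bound
    (∀ O : Set (PV 𝒳), IsOpen O →
      - ⨅ μ ∈ O, I μ ≤
      Filter.liminf
        (fun n : ℕ => (((n : ℝ)⁻¹ : ℝ) : EReal) *
          elog (condP (jointWeight poissonLaw μ0 Q) n
            {t | ∃ h : IsProbVec (empPair t), (⟨empPair t, h⟩ : PV 𝒳) ∈ O}))
        (Filter.atTop ⊓ Filter.principal S)) := by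
  obtain rfl : I = fun μ : PV 𝒳 => ratePoisson Q μ.1 := funext hI
  have hlsc := lowerSemicontinuous_ratePoisson hQ_nonneg hQ_sum
  refine ⟨fun x hx => cramerRate_poissonLaw hx, hlsc,
    fun c => (hlsc.isClosed_preimage (c : EReal)).isCompact, fun F hF => ?_, fun O hO => ?_⟩
  · refine EReal.le_of_forall_lt_iff_le.1 fun z hz => Filter.limsup_le_of_le (h := ?_)
    exact Filter.Eventually.filter_mono inf_le_left
      (eventually_inv_mul_elog_condP_le hμ0_nonneg hμ0_sum hQ_nonneg hQ_sum hQ_irr hF hz)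
  · refine EReal.ge_of_forall_gt_iff_ge.1 fun z hz => Filter.le_liminf_of_le (h := ?_)
    exact Filter.Eventually.filter_mono inf_le_left
      (eventually_le_inv_mul_elog_condP hμ0_nonneg hμ0_sum hQ_nonneg hQ_sum hQ_irr hO hz)

end Statement3
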